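/- arXiv:1109.2274 — 5 statements merged into one kernel-verified Lean document; each statement's English description precedes it below -/
import Mathlib

section
/- Let a be a fixed positive integer and let χ be a nonprincipal Dirichlet character modulo a with χ² equal to the principal character. Then Σ_{p ≤ N, χ(p) = 1} 1/p = (1/2)·log log N + O(1) for N ≥ 3, where the sum runs over primes p ≤ N with χ(p) = 1 and the implied constant may depend on a. -/
open scoped Classical

open Finset Filter Topology

theorem norm_sum_range_smul_le_of_antitone {E : Type*} [NormedAddCommGroup E] [NormedSpace ℝ E]
    {g : ℕ → ℝ} {c : ℕ → E} {B : ℝ} (hg : Antitone g) (hg0 : ∀ n, 0 ≤ g n)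
    (hc : ∀ n, ‖∑ i ∈ range n, c i‖ ≤ B) (n : ℕ) :
    ‖∑ i ∈ range n, g i • c i‖ ≤ B * g 0 := by
  rw [sum_range_by_parts]
  calc _ ≤ ‖g (n - 1) • ∑ i ∈ range n, c i‖ +
        ∑ i ∈ range (n - 1), ‖(g (i + 1) - g i) • ∑ j ∈ range (i + 1), c j‖ :=
        (norm_sub_le _ _).trans (by gcongr; exact norm_sum_le _ _)
    _ ≤ g (n - 1) * B + ∑ i ∈ range (n - 1), (g i - g (i + 1)) * B := by
        gcongr with i hi
        · rw [norm_smul, Real.norm_of_nonneg (hg0 _)]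
          exact mul_le_mul_of_nonneg_left (hc n) (hg0 _)
        · have h : 0 ≤ g i - g (i + 1) := sub_nonneg.mpr (hg i.le_succ)
          rw [norm_smul, norm_sub_rev, Real.norm_of_nonneg h]
          exact mul_le_mul_of_nonneg_left (hc _) h
    _ = B * g 0 := by
        rw [← sum_mul, sum_range_sub']
        ring

theorem norm_sum_Ioc_smul_le_of_antitoneOn {E : Type*} [NormedAddCommGroup E] [NormedSpace ℝ E]
    {g : ℕ → ℝ} {c : ℕ → E} {B : ℝ} {m : ℕ} (hg : AntitoneOn g (Set.Ioi m))
    (hg0 : ∀ n, m < n → 0 ≤ g n) (hc : ∀ n, ‖∑ i ∈ Ioc 0 n, c i‖ ≤ B) (n : ℕ) :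
    ‖∑ i ∈ Ioc m n, g i • c i‖ ≤ 2 * B * g (m + 1) := by
  have key := norm_sum_range_smul_le_of_antitone (g := fun i ↦ g (m + 1 + i))
    (c := fun i ↦ c (m + 1 + i)) (B := 2 * B)
    (fun i j hij ↦ hg (by simp; omega) (by simp; omega) (by omega))
    (fun i ↦ hg0 _ (by omega)) (fun k ↦ by
      have h : ∑ i ∈ range k, c (m + 1 + i) = ∑ i ∈ Ioc 0 (m + k), c i - ∑ i ∈ Ioc 0 m, c i := by
        rw [← sum_Ioc_consecutive c (Nat.zero_le m) (Nat.le_add_right m k), add_sub_cancel_left,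
          ← Ico_add_one_add_one_eq_Ioc, sum_Ico_eq_sum_range]
        congr 2
        omega
      rw [h, two_mul]
      exact (norm_sub_le _ _).trans (add_le_add (hc _) (hc _))) (n - m)
  rw [← Ico_add_one_add_one_eq_Ioc, sum_Ico_eq_sum_range, Nat.add_sub_add_right]
  exact key

theorem DirichletCharacter.norm_sum_range_le {a : ℕ} [NeZero a] {χ : DirichletCharacter ℂ a}
    (hχ : χ ≠ 1) (n : ℕ) : ‖∑ i ∈ range n, χ (i : ZMod a)‖ ≤ a := by
  have hperiod : ∑ i ∈ range a, χ (i : ZMod a) = 0 := by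
    rw [← MulChar.sum_eq_zero_of_ne_one hχ]
    obtain ⟨k, rfl⟩ := Nat.exists_eq_succ_of_ne_zero (NeZero.ne a)
    rw [← Fin.sum_univ_eq_sum_range (fun i ↦ χ (i : ZMod (k + 1)))]
    exact sum_congr rfl fun x _ ↦ congrArg χ (Fin.cast_val_eq_self (n := k + 1) x)
  have hS : Function.Periodic (fun n ↦ ∑ i ∈ range n, χ (i : ZMod a)) a := fun n ↦ by
    simp only
    rw [add_comm n a, sum_range_add, hperiod]
    simp
  rw [← hS.map_mod_nat n]
  calc _ ≤ ∑ i ∈ range (n % a), ‖χ (i : ZMod a)‖ := norm_sum_le _ _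
    _ ≤ ∑ i ∈ range (n % a), 1 := sum_le_sum fun i _ ↦ χ.norm_le_one _
    _ ≤ a := by simpa using (Nat.mod_lt n (NeZero.pos a)).le

theorem DirichletCharacter.norm_sum_Ioc_le {a : ℕ} [NeZero a] {χ : DirichletCharacter ℂ a}
    (hχ : χ ≠ 1) (n : ℕ) : ‖∑ i ∈ Ioc 0 n, χ (i : ZMod a)‖ ≤ 2 * a := by
  have h : ∑ i ∈ Ioc 0 n, χ (i : ZMod a) =
      ∑ i ∈ range (n + 1), χ (i : ZMod a) - ∑ i ∈ range 1, χ (i : ZMod a) := by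
    rw [← sum_Ico_eq_sub _ (by omega), ← Ico_add_one_add_one_eq_Ioc, zero_add]
  rw [h, two_mul]
  exact (norm_sub_le _ _).trans
    (add_le_add (DirichletCharacter.norm_sum_range_le hχ _) (DirichletCharacter.norm_sum_range_le hχ _))

theorem DirichletCharacter.norm_LFunction_one_sub_sum_le {a : ℕ} [NeZero a]
    {χ : DirichletCharacter ℂ a} (hχ : χ ≠ 1) (N : ℕ) :
    ‖χ.LFunction 1 - ∑ n ∈ Ioc 0 N, χ (n : ZMod a) / n‖ ≤ 4 * a / (N + 1) := by
  have hs (s : ℝ) (hs : 1 < s) :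
      ‖χ.LFunction s - ∑ n ∈ Ioc 0 N, χ (n : ZMod a) / (n : ℂ) ^ (s : ℂ)‖ ≤ 4 * a / (N + 1) := by
    have h1 : 1 < (s : ℂ).re := by simpa
    rw [χ.LFunction_eq_LSeries h1]
    have hsum := (χ.LSeriesSummable_of_one_lt_re h1).LSeriesHasSum
    have hlim := (HasSum.tendsto_sum_nat hsum).comp (tendsto_add_atTop_nat 1)
    refine le_of_tendsto (hlim.sub_const _).norm ?_
    filter_upwards [eventually_ge_atTop N] with M hM
    have hsplit : ∑ i ∈ range (M + 1), LSeries.term (fun n ↦ χ (n : ZMod a)) s i -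
        ∑ n ∈ Ioc 0 N, χ (n : ZMod a) / (n : ℂ) ^ (s : ℂ) =
        ∑ n ∈ Ioc N M, ((n : ℝ) ^ (-s)) • χ (n : ZMod a) := by
      have hterm : ∑ i ∈ range (M + 1), LSeries.term (fun n ↦ χ (n : ZMod a)) s i =
          ∑ n ∈ Ioc 0 M, χ (n : ZMod a) / (n : ℂ) ^ (s : ℂ) := by
        rw [sum_range_succ', LSeries.term_zero, add_zero, ← Ico_add_one_add_one_eq_Ioc,
          sum_Ico_eq_sum_range]
        refine sum_congr (by simp) fun i _ ↦ ?_
        rw [LSeries.term_of_ne_zero (by omega), zero_add, add_comm 1 i]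
      rw [hterm, ← sum_Ioc_consecutive _ (Nat.zero_le N) hM, add_sub_cancel_left]
      refine sum_congr rfl fun n _ ↦ ?_
      rw [Complex.real_smul, Complex.ofReal_cpow (by positivity)]
      simp [Complex.cpow_neg, div_eq_inv_mul]
    simp only [Function.comp_apply]
    rw [hsplit]
    refine (norm_sum_Ioc_smul_le_of_antitoneOn (fun x hx y hy hxy ↦ ?_) (fun n _ ↦ by positivity)
      (DirichletCharacter.norm_sum_Ioc_le hχ) M).trans ?_
    · have : 0 < x := (Nat.zero_le N).trans_lt hx
      exact Real.rpow_le_rpow_of_nonpos (by exact_mod_cast this) (by exact_mod_cast hxy)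
        (by linarith)
    · rw [Nat.cast_add_one, div_eq_mul_inv, ← Real.rpow_neg_one]
      have : ((N : ℝ) + 1) ^ (-s) ≤ ((N : ℝ) + 1) ^ (-1 : ℝ) :=
        Real.rpow_le_rpow_of_exponent_le (by linarith [Nat.cast_nonneg (α := ℝ) N]) (by linarith)
      calc _ ≤ 2 * (2 * (a : ℝ)) * ((N : ℝ) + 1) ^ (-1 : ℝ) := by gcongr
        _ = _ := by ring
  have hcont : Continuous fun s : ℝ ↦
      ‖χ.LFunction s - ∑ n ∈ Ioc 0 N, χ (n : ZMod a) / (n : ℂ) ^ (s : ℂ)‖ := by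
    refine (((DirichletCharacter.differentiable_LFunction hχ).continuous.comp
      Complex.continuous_ofReal).sub (continuous_finsetSum _ fun n hn ↦ ?_)).norm
    have hn : (n : ℂ) ≠ 0 := by
      simp only [mem_Ioc] at hn
      exact_mod_cast hn.1.ne'
    exact continuous_const.div (Complex.continuous_ofReal.const_cpow (.inl hn))
      fun s ↦ by simp [Complex.cpow_eq_zero_iff, hn]
  have hlim := (hcont.tendsto 1).mono_left (nhdsWithin_le_nhds (s := Set.Ioi 1))
  simpa using le_of_tendsto hlim (eventually_nhdsWithin_of_forall hs)

open ArithmeticFunction (vonMangoldt)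

theorem sum_Ioc_vonMangoldt_le (N : ℕ) :
    ∑ n ∈ Ioc 0 N, vonMangoldt n ≤ (Real.log 4 + 4) * N := by
  simpa [Chebyshev.psi] using Chebyshev.psi_le_const_mul_self (x := N) (by positivity)

theorem DirichletCharacter.exists_norm_sum_mul_log_div_le {a : ℕ} [NeZero a]
    {χ : DirichletCharacter ℂ a} (hχ : χ ≠ 1) :
    ∃ C : ℝ, ∀ N : ℕ, ‖∑ n ∈ Ioc 0 N, χ (n : ZMod a) * Real.log n / n‖ ≤ C := by
  have hterm (n : ℕ) : χ (n : ZMod a) * Real.log n / n =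
      (Real.log n / n : ℝ) • χ (n : ZMod a) := by
    rw [Complex.real_smul]
    push_cast
    ring
  refine ⟨∑ n ∈ Ioc (0 : ℕ) 2, ‖χ (n : ZMod a) * Real.log n / n‖ +
    2 * (2 * a) * (Real.log 3 / 3), fun N ↦ ?_⟩
  have htail : ‖∑ n ∈ Ioc 2 N, χ (n : ZMod a) * Real.log n / n‖ ≤
      2 * (2 * a) * (Real.log 3 / 3) := by
    simp only [hterm]
    refine (norm_sum_Ioc_smul_le_of_antitoneOn (g := fun n : ℕ ↦ Real.log n / n)
      (fun x hx y hy hxy ↦ ?_) (fun n _ ↦ by positivity)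
      (DirichletCharacter.norm_sum_Ioc_le hχ) N).trans (by norm_num)
    have he : Real.exp 1 ≤ 3 := Real.exp_one_lt_three.le
    have hmem {z : ℕ} (hz : z ∈ Set.Ioi 2) : (z : ℝ) ∈ Set.Ici (Real.exp 1) :=
      he.trans (by exact_mod_cast (Set.mem_Ioi.mp hz))
    exact Real.log_div_self_antitoneOn (hmem hx) (hmem hy) (by exact_mod_cast hxy)
  rcases le_total 2 N with h | h
  · rw [← sum_Ioc_consecutive _ (Nat.zero_le 2) h]
    exact (norm_add_le _ _).trans (add_le_add (norm_sum_le _ _) htail)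
  · refine (norm_sum_le _ _).trans ((sum_le_sum_of_subset_of_nonneg (Ioc_subset_Ioc_right h)
      fun _ _ _ ↦ norm_nonneg _).trans (le_add_of_nonneg_right (by positivity)))

theorem DirichletCharacter.exists_norm_sum_mul_vonMangoldt_div_le {a : ℕ} [NeZero a]
    {χ : DirichletCharacter ℂ a} (hχ : χ ≠ 1) :
    ∃ C : ℝ, ∀ N : ℕ, ‖∑ n ∈ Ioc 0 N, χ (n : ZMod a) * vonMangoldt n / n‖ ≤ C := by
  obtain ⟨C, hC⟩ := DirichletCharacter.exists_norm_sum_mul_log_div_le hχ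
  have hL := norm_pos_iff.mpr (DirichletCharacter.LFunction_apply_one_ne_zero hχ)
  refine ⟨(C + 4 * a * (Real.log 4 + 4)) / ‖χ.LFunction 1‖, fun N ↦ ?_⟩
  rw [le_div_iff₀ hL, ← norm_mul]
  let f : ArithmeticFunction ℂ := ⟨fun n ↦ χ (n : ZMod a) * vonMangoldt n / n, by simp⟩
  let g : ArithmeticFunction ℂ := ⟨fun n ↦ χ (n : ZMod a) / n, by simp⟩
  have hfg (n : ℕ) : (f * g) n = χ (n : ZMod a) * Real.log n / n := by
    rw [ArithmeticFunction.mul_apply, ← ArithmeticFunction.vonMangoldt_sum,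
      show ∑ d ∈ n.divisors, vonMangoldt d = ∑ x ∈ n.divisorsAntidiagonal, vonMangoldt x.1 from
        (Nat.sum_divisorsAntidiagonal (fun d _ ↦ vonMangoldt d)).symm]
    push_cast
    rw [mul_sum, sum_div]
    refine sum_congr rfl fun x hx ↦ ?_
    rw [← (Nat.mem_divisorsAntidiagonal.mp hx).1]
    simp only [f, g, ArithmeticFunction.coe_mk, Nat.cast_mul, map_mul]
    ring
  have hconv := ArithmeticFunction.sum_Ioc_mul_eq_sum_sum f g N
  simp only [hfg] at hconv
  have hsplit : (∑ n ∈ Ioc 0 N, f n) * χ.LFunction 1 =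
      ∑ n ∈ Ioc 0 N, χ (n : ZMod a) * Real.log n / n +
        ∑ n ∈ Ioc 0 N, f n * (χ.LFunction 1 - ∑ m ∈ Ioc 0 (N / n), g m) := by
    rw [hconv, ← sum_add_distrib, sum_mul]
    exact sum_congr rfl fun n _ ↦ by ring
  have herr : ‖∑ n ∈ Ioc 0 N, f n * (χ.LFunction 1 - ∑ m ∈ Ioc 0 (N / n), g m)‖ ≤
      4 * a * (Real.log 4 + 4) := by
    rcases N.eq_zero_or_pos with rfl | hN
    · simp
      positivity
    have hN' : (0 : ℝ) < N := by exact_mod_cast hN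
    calc _ ≤ ∑ n ∈ Ioc 0 N, 4 * a / N * vonMangoldt n := by
          refine (norm_sum_le _ _).trans (sum_le_sum fun n hn ↦ ?_)
          have hn0 : 0 < n := (mem_Ioc.mp hn).1
          have hn' : (0 : ℝ) < n := by exact_mod_cast hn0
          have hf : ‖f n‖ ≤ vonMangoldt n / n := by
            simp only [f, ArithmeticFunction.coe_mk, norm_div, norm_mul, Complex.norm_real,
              Complex.norm_natCast]
            rw [Real.norm_of_nonneg ArithmeticFunction.vonMangoldt_nonneg]
            gcongr
            exact mul_le_of_le_one_left ArithmeticFunction.vonMangoldt_nonneg (χ.norm_le_one _)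
          have hlt : (N : ℝ) ≤ n * ((N / n : ℕ) + 1) := by
            exact_mod_cast (Nat.lt_mul_div_succ N hn0).le
          rw [norm_mul]
          calc _ ≤ vonMangoldt n / n * (4 * a / ((N / n : ℕ) + 1)) :=
                mul_le_mul hf (DirichletCharacter.norm_LFunction_one_sub_sum_le hχ _)
                  (norm_nonneg _) (div_nonneg ArithmeticFunction.vonMangoldt_nonneg hn'.le)
            _ = 4 * a / (n * ((N / n : ℕ) + 1)) * vonMangoldt n := by
                field_simp
            _ ≤ _ := by
                gcongr
      _ ≤ 4 * a / N * ((Real.log 4 + 4) * N) := by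
          rw [← mul_sum]
          gcongr
          exact sum_Ioc_vonMangoldt_le N
      _ = _ := by field_simp
  exact hsplit ▸ (norm_add_le _ _).trans (add_le_add (hC N) herr)

theorem exists_abs_sum_vonMangoldt_div_sub_log_le :
    ∃ C : ℝ, ∀ N : ℕ, |∑ n ∈ Ioc 0 N, vonMangoldt n / n - Real.log N| ≤ C := by
  refine ⟨Real.log 4 + 5, fun N ↦ ?_⟩
  rcases N.eq_zero_or_pos with rfl | hN
  · simp
    positivity
  have hN' : (0 : ℝ) < N := by exact_mod_cast hN
  have hfac : ∑ n ∈ Ioc 0 N, vonMangoldt n * (N / n : ℕ) = Real.log N.factorial := by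
    rw [← ArithmeticFunction.sum_Ioc_mul_zeta_eq_sum, ArithmeticFunction.vonMangoldt_mul_zeta,
      ← prod_Ico_id_eq_factorial, Nat.cast_prod, Real.log_prod]
    · rfl
    · intro i hi
      have := (mem_Icc.mp hi).1
      positivity
  have hupper : ∑ n ∈ Ioc 0 N, vonMangoldt n * (N / n : ℕ) ≤
      N * ∑ n ∈ Ioc 0 N, vonMangoldt n / n := by
    rw [mul_sum]
    refine sum_le_sum fun n _ ↦ ?_
    calc _ ≤ vonMangoldt n * ((N : ℝ) / n) :=
          mul_le_mul_of_nonneg_left Nat.cast_div_le ArithmeticFunction.vonMangoldt_nonneg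
      _ = _ := by ring
  have hlower : N * ∑ n ∈ Ioc 0 N, vonMangoldt n / n ≤
      ∑ n ∈ Ioc 0 N, vonMangoldt n * (N / n : ℕ) + ∑ n ∈ Ioc 0 N, vonMangoldt n := by
    rw [mul_sum, ← sum_add_distrib]
    refine sum_le_sum fun n hn ↦ ?_
    have hn0 : 0 < n := (mem_Ioc.mp hn).1
    have hn' : (0 : ℝ) < n := by exact_mod_cast hn0
    have hlt : (N : ℝ) / n ≤ (N / n : ℕ) + 1 := by
      rw [div_le_iff₀' hn']
      exact_mod_cast (Nat.lt_mul_div_succ N hn0).le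
    calc _ = vonMangoldt n * ((N : ℝ) / n) := by ring
      _ ≤ vonMangoldt n * ((N / n : ℕ) + 1) :=
          mul_le_mul_of_nonneg_left hlt ArithmeticFunction.vonMangoldt_nonneg
      _ = _ := by ring
  have hpsi := sum_Ioc_vonMangoldt_le N
  have hlog_le : Real.log N.factorial ≤ N * Real.log N := by
    rw [← Real.log_pow]
    exact Real.log_le_log (by positivity) (by exact_mod_cast Nat.factorial_le_pow N)
  have hle_log : N * Real.log N - N ≤ Real.log N.factorial := by
    have h1 := Stirling.le_log_factorial_stirling hN.ne'
    have h2 : 0 ≤ Real.log N := Real.log_natCast_nonneg N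
    have h3 : 0 ≤ Real.log (2 * Real.pi) := Real.log_nonneg (by linarith [Real.pi_gt_three])
    linarith
  rw [abs_le]
  constructor
  · refine le_of_mul_le_mul_left ?_ hN'
    have : 0 ≤ Real.log 4 * N := by positivity
    linarith
  · refine le_of_mul_le_mul_left ?_ hN'
    linarith

theorem log_log_succ_sub_le {k : ℕ} (hk : 2 ≤ k) :
    Real.log (Real.log (k + 1 : ℕ)) - Real.log (Real.log k) ≤ 1 / (k * Real.log k) := by
  have hk0 : (0 : ℝ) < k := by positivity
  have hlk : 0 < Real.log k := Real.log_pos (by exact_mod_cast hk)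
  have hlk' : 0 < Real.log (k + 1 : ℕ) := Real.log_pos (by exact_mod_cast (by omega))
  have h1 : Real.log (k + 1 : ℕ) - Real.log k ≤ 1 / k := by
    rw [← Real.log_div (by positivity) hk0.ne']
    refine (Real.log_le_sub_one_of_pos (by positivity)).trans_eq ?_
    push_cast
    field_simp
    ring
  rw [← Real.log_div hlk'.ne' hlk.ne']
  refine (Real.log_le_sub_one_of_pos (by positivity)).trans ?_
  calc _ = (Real.log (k + 1 : ℕ) - Real.log k) / Real.log k := by field_simp
    _ ≤ 1 / k / Real.log k := by gcongr
    _ = _ := by field_simp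

theorem le_log_log_succ_sub {k : ℕ} (hk : 2 ≤ k) :
    1 / ((k + 1 : ℕ) * Real.log (k + 1 : ℕ)) ≤
      Real.log (Real.log (k + 1 : ℕ)) - Real.log (Real.log k) := by
  have hk0 : (0 : ℝ) < k := by positivity
  have hlk : 0 < Real.log k := Real.log_pos (by exact_mod_cast hk)
  have hlk' : 0 < Real.log (k + 1 : ℕ) := Real.log_pos (by exact_mod_cast (by omega))
  have h1 : 1 / ((k + 1 : ℕ) : ℝ) ≤ Real.log (k + 1 : ℕ) - Real.log k := by
    rw [← Real.log_div (by positivity) hk0.ne']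
    refine Eq.trans_le ?_ (Real.one_sub_inv_le_log_of_pos (by positivity))
    push_cast
    field_simp
    ring
  rw [← Real.log_div hlk'.ne' hlk.ne']
  refine le_trans ?_ (Real.one_sub_inv_le_log_of_pos (by positivity))
  calc _ = 1 / ((k + 1 : ℕ) : ℝ) / Real.log (k + 1 : ℕ) := by field_simp
    _ ≤ (Real.log (k + 1 : ℕ) - Real.log k) / Real.log (k + 1 : ℕ) := by gcongr
    _ = _ := by field_simp

theorem exists_abs_sum_one_div_mul_log_sub_log_log_le :
    ∃ C : ℝ, ∀ N : ℕ, 2 ≤ N →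
      |∑ n ∈ Ioc 1 N, 1 / (n * Real.log n) - Real.log (Real.log N)| ≤ C := by
  refine ⟨|Real.log (Real.log 2)| + 1 / (2 * Real.log 2), fun N hN ↦ ?_⟩
  have hbound : Real.log (Real.log (N + 1 : ℕ)) - Real.log (Real.log 2) ≤
      ∑ n ∈ Ioc 1 N, 1 / (n * Real.log n) ∧ ∑ n ∈ Ioc 1 N, 1 / (n * Real.log n) ≤
        Real.log (Real.log N) - Real.log (Real.log 2) + 1 / (2 * Real.log 2) := by
    induction N, hN using Nat.le_induction with
    | base =>
      have h := log_log_succ_sub_le le_rfl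
      have hs : Ioc 1 2 = {2} := rfl
      rw [hs, sum_singleton]
      exact ⟨by exact_mod_cast h, by simp⟩
    | succ k hk ih =>
      have h1 := log_log_succ_sub_le (k := k + 1) (by omega)
      have h2 := le_log_log_succ_sub hk
      rw [sum_Ioc_succ_top (by omega)]
      constructor <;> linarith [ih.1, ih.2]
  have hmono : Real.log (Real.log N) ≤ Real.log (Real.log (N + 1 : ℕ)) := by
    have hN1 : (1 : ℝ) < N := by exact_mod_cast hN
    exact Real.log_le_log (Real.log_pos hN1)
      (Real.log_le_log (by linarith) (by push_cast; linarith))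
  have hpos : 0 ≤ 1 / (2 * Real.log 2) := by positivity
  have habs := neg_abs_le (Real.log (Real.log 2))
  have habs' := le_abs_self (Real.log (Real.log 2))
  rw [abs_le]
  constructor <;> linarith [hbound.1, hbound.2]

theorem abs_sum_one_div_sub_log_le (N : ℕ) :
    |∑ n ∈ Ioc 0 N, (1 / n : ℝ) - Real.log N| ≤ 1 := by
  rcases N.eq_zero_or_pos with rfl | hN
  · simp
  have hN' : (0 : ℝ) < N := by exact_mod_cast hN
  have heq : ∑ n ∈ Ioc 0 N, (1 / n : ℝ) = harmonic N := by
    rw [harmonic_eq_sum_Icc]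
    push_cast
    exact sum_congr rfl fun n _ ↦ one_div _
  have h1 := log_add_one_le_harmonic N
  have h2 := harmonic_le_one_add_log N
  have h3 : Real.log N ≤ Real.log (N + 1 : ℕ) :=
    Real.log_le_log hN' (by push_cast; linarith)
  rw [heq, abs_le]
  constructor <;> linarith

theorem exists_sum_not_prime_vonMangoldt_div_le :
    ∃ C : ℝ, ∀ N : ℕ, ∑ n ∈ Ioc 0 N, (if n.Prime then 0 else vonMangoldt n) / n ≤ C := by
  have h := ArithmeticFunction.vonMangoldt.summable_residueClass_non_primes_div (q := 1) 0
  refine ⟨∑' n : ℕ, (if n.Prime then 0 else vonMangoldt n) / n, fun N ↦ ?_⟩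
  refine Summable.sum_le_tsum _ (fun n _ ↦ ?_) (h.congr fun n ↦ ?_)
  · split_ifs
    · simp
    · exact div_nonneg ArithmeticFunction.vonMangoldt_nonneg n.cast_nonneg
  · simp [Subsingleton.elim (n : ZMod 1) 0]

theorem DirichletCharacter.exists_abs_sum_prime_one_add_re_mul_log_div_sub_log_le {a : ℕ}
    [NeZero a] {χ : DirichletCharacter ℂ a} (hχ : χ ≠ 1) :
    ∃ C : ℝ, ∀ N : ℕ, |∑ n ∈ Ioc 0 N, (if n.Prime then (1 + (χ (n : ZMod a)).re) *
      Real.log n / n else 0) - Real.log N| ≤ C := by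
  obtain ⟨C₁, h₁⟩ := exists_abs_sum_vonMangoldt_div_sub_log_le
  obtain ⟨C₂, h₂⟩ := DirichletCharacter.exists_norm_sum_mul_vonMangoldt_div_le hχ
  obtain ⟨C₃, h₃⟩ := exists_sum_not_prime_vonMangoldt_div_le
  refine ⟨C₁ + C₂ + 2 * C₃, fun N ↦ ?_⟩
  have hre : |∑ n ∈ Ioc 0 N, (χ (n : ZMod a)).re * vonMangoldt n / n| ≤ C₂ := by
    refine Eq.trans_le (congrArg _ ?_) ((Complex.abs_re_le_norm _).trans (h₂ N))
    rw [Complex.re_sum]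
    refine sum_congr rfl fun n _ ↦ ?_
    rw [← Complex.ofReal_natCast n, Complex.div_ofReal_re, Complex.re_mul_ofReal]
  have hdiff : |∑ n ∈ Ioc 0 N, (1 + (χ (n : ZMod a)).re) *
      ((if n.Prime then 0 else vonMangoldt n) / n)| ≤ 2 * C₃ := by
    refine (abs_sum_le_sum_abs _ _).trans (le_trans ?_
      (mul_le_mul_of_nonneg_left (h₃ N) zero_le_two))
    rw [mul_sum]
    refine sum_le_sum fun n _ ↦ ?_
    have hnonneg : 0 ≤ (if n.Prime then 0 else vonMangoldt n) / n := by
      split_ifs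
      · simp
      · exact div_nonneg ArithmeticFunction.vonMangoldt_nonneg n.cast_nonneg
    rw [abs_mul, abs_of_nonneg hnonneg]
    refine mul_le_mul_of_nonneg_right ?_ hnonneg
    have := (Complex.abs_re_le_norm _).trans (χ.norm_le_one (n : ZMod a))
    rw [abs_le] at this ⊢
    constructor <;> linarith
  have hsplit : ∑ n ∈ Ioc 0 N, (if n.Prime then (1 + (χ (n : ZMod a)).re) *
      Real.log n / n else 0) = ∑ n ∈ Ioc 0 N, vonMangoldt n / n +
        ∑ n ∈ Ioc 0 N, (χ (n : ZMod a)).re * vonMangoldt n / n -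
          ∑ n ∈ Ioc 0 N, (1 + (χ (n : ZMod a)).re) *
            ((if n.Prime then 0 else vonMangoldt n) / n) := by
    rw [← sum_add_distrib, ← sum_sub_distrib]
    refine sum_congr rfl fun n _ ↦ ?_
    split_ifs with hn
    · rw [ArithmeticFunction.vonMangoldt_apply_prime hn]
      ring
    · ring
  have h₁' := h₁ N
  rw [hsplit]
  rw [abs_le] at *
  constructor <;> linarith

theorem DirichletCharacter.exists_abs_sum_prime_one_add_re_div_sub_log_log_le {a : ℕ}
    [NeZero a] {χ : DirichletCharacter ℂ a} (hχ : χ ≠ 1) :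
    ∃ C : ℝ, ∀ N : ℕ, 2 ≤ N → |∑ n ∈ Ioc 1 N, (if n.Prime then (1 + (χ (n : ZMod a)).re) / n
      else 0) - Real.log (Real.log N)| ≤ C := by
  obtain ⟨C₁, h₁⟩ :=
    DirichletCharacter.exists_abs_sum_prime_one_add_re_mul_log_div_sub_log_le hχ
  obtain ⟨C₂, h₂⟩ := exists_abs_sum_one_div_mul_log_sub_log_log_le
  refine ⟨2 * (C₁ + 1) * (Real.log (1 + 1 : ℕ))⁻¹ + C₂, fun N hN ↦ ?_⟩
  have hparts := norm_sum_Ioc_smul_le_of_antitoneOn (m := 1) (B := C₁ + 1)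
    (g := fun n : ℕ ↦ (Real.log n)⁻¹)
    (c := fun n : ℕ ↦ (if n.Prime then (1 + (χ (n : ZMod a)).re) * Real.log n / n else 0) -
      1 / (n : ℝ))
    (fun x hx y hy hxy ↦ by
      have hx' : (1 : ℝ) < x := by exact_mod_cast (Set.mem_Ioi.mp hx)
      have hlog := Real.log_pos hx'
      have hxy' : (x : ℝ) ≤ y := by exact_mod_cast hxy
      simp only
      gcongr)
    (fun n _ ↦ by positivity)
    (fun n ↦ by
      have h := h₁ n
      have h' := abs_sum_one_div_sub_log_le n
      rw [sum_sub_distrib, Real.norm_eq_abs]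
      rw [abs_le] at *
      constructor <;> linarith) N
  have heq : ∑ n ∈ Ioc 1 N, (Real.log n)⁻¹ • ((if n.Prime then (1 + (χ (n : ZMod a)).re) *
      Real.log n / n else 0) - 1 / (n : ℝ)) =
      ∑ n ∈ Ioc 1 N, (if n.Prime then (1 + (χ (n : ZMod a)).re) / n else 0) -
        ∑ n ∈ Ioc 1 N, 1 / (n * Real.log n) := by
    rw [← sum_sub_distrib]
    refine sum_congr rfl fun n hn ↦ ?_
    have hn1 : (1 : ℝ) < n := by exact_mod_cast (mem_Ioc.mp hn).1
    have hlog := Real.log_pos hn1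
    split_ifs
    · simp only [smul_eq_mul]
      field_simp
    · simp only [smul_eq_mul]
      field_simp
      ring
  rw [heq, Real.norm_eq_abs] at hparts
  have h₂' := h₂ N hN
  rw [abs_le] at *
  constructor <;> linarith

theorem DirichletCharacter.sum_prime_apply_eq_zero_le {a : ℕ} (ha : 0 < a)
    (χ : DirichletCharacter ℂ a) (N : ℕ) :
    ∑ n ∈ Ioc 1 N, (if n.Prime ∧ χ (n : ZMod a) = 0 then (1 / n : ℝ) else 0) ≤
      ∑ n ∈ Ioc 0 a, (1 / n : ℝ) := by
  rw [← sum_filter]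
  refine sum_le_sum_of_subset_of_nonneg (fun n hn ↦ ?_) fun _ _ _ ↦ by positivity
  obtain ⟨-, hp, h0⟩ := mem_filter.mp hn
  have hdvd : n ∣ a := by
    by_contra h
    exact ((ZMod.isUnit_iff_coprime n a).mpr ((Nat.Prime.coprime_iff_not_dvd hp).mpr h)).map χ
      |>.ne_zero h0
  exact mem_Ioc.mpr ⟨hp.pos, Nat.le_of_dvd ha hdvd⟩

/-- For a nonprincipal quadratic character `χ` modulo `a`,
`∑_{p ≤ N, χ(p) = 1} 1/p = (1/2) log log N + O(1)`. -/
theorem stmt14 (a : ℕ) (ha : 0 < a) (χ : DirichletCharacter ℂ a)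
    (hχ : χ ^ 2 = 1) (hχ0 : χ ≠ 1) :
    ∃ C : ℝ, ∀ N : ℕ, 3 ≤ N →
      |(∑ p ∈ (Finset.Icc 1 N).filter
            (fun (p : ℕ) => p.Prime ∧ χ (p : ZMod a) = 1), (1 / p : ℝ)) -
          (1 / 2) * Real.log (Real.log N)| ≤ C := by
  have : NeZero a := ⟨ha.ne'⟩
  obtain ⟨C, hC⟩ := DirichletCharacter.exists_abs_sum_prime_one_add_re_div_sub_log_log_le hχ0
  refine ⟨(C + ∑ n ∈ Ioc 0 a, (1 / n : ℝ)) / 2, fun N hN ↦ ?_⟩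
  have hzero := DirichletCharacter.sum_prime_apply_eq_zero_le ha χ N
  have hzero_nonneg : 0 ≤ ∑ n ∈ Ioc 1 N,
      (if n.Prime ∧ χ (n : ZMod a) = 0 then (1 / n : ℝ) else 0) :=
    sum_nonneg fun n _ ↦ by positivity
  have hsum : ∑ p ∈ (Finset.Icc 1 N).filter
      (fun (p : ℕ) => p.Prime ∧ χ (p : ZMod a) = 1), (1 / p : ℝ) =
      (∑ n ∈ Ioc 1 N, (if n.Prime then (1 + (χ (n : ZMod a)).re) / n else 0) -
        ∑ n ∈ Ioc 1 N, (if n.Prime ∧ χ (n : ZMod a) = 0 then (1 / n : ℝ) else 0)) / 2 := by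
    rw [sum_filter, ← add_sum_Ioc_eq_sum_Icc (by omega), if_neg (by simp [Nat.not_prime_one]),
      zero_add, ← sum_sub_distrib, sum_div]
    refine sum_congr rfl fun n _ ↦ ?_
    by_cases hp : n.Prime
    · rcases MulChar.isQuadratic_iff_sq_eq_one.mpr hχ (n : ZMod a) with h | h | h <;>
        norm_num [hp, h]
      field_simp
    · simp [hp]
  have h := hC N (by omega)
  rw [hsum]
  rw [abs_le] at *
  constructor <;> linarith
end

section
/- Let χ be a Dirichlet character modulo a with χ² equal to the principal character, and for a positive integer n set g_χ(n) = Σ_{u | n²} χ(u), the sum over positive divisors u of n². Then 0 < g_χ(n) ≤ 3^{Ω_χ(n)} for every positive integer n. -/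
open scoped Classical

/-- `OmegaChi χ n` is the number of pairs `(p, k)` with `p` prime, `k ≥ 1`,
`p ^ k ∣ n` and `χ(p ^ k) = 1`. -/
noncomputable def OmegaChi {a : ℕ} (χ : DirichletCharacter ℝ a) (n : ℕ) : ℕ :=
  Nat.card {pk : ℕ × ℕ | pk.1.Prime ∧ 1 ≤ pk.2 ∧ pk.1 ^ pk.2 ∣ n ∧
    χ (((pk.1 ^ pk.2 : ℕ) : ZMod a)) = 1}

/-- Divisor sums of a Dirichlet character are multiplicative. -/
theorem sum_divisors_mul_dirichletCharacter {a : ℕ} (χ : DirichletCharacter ℝ a) {m n : ℕ}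
    (hmn : m.Coprime n) :
    ∑ u ∈ (m * n).divisors, χ (u : ZMod a) =
      (∑ u ∈ m.divisors, χ (u : ZMod a)) * ∑ u ∈ n.divisors, χ (u : ZMod a) := by
  rw [Finset.sum_mul_sum, ← Finset.sum_product', Nat.divisors_mul, ← Finset.image_mul_product,
    Finset.sum_image hmn.mul_injOn_divisors]
  simp

/-- The prime powers `(p, k)` dividing `n` with `χ(p ^ k) = 1`. -/
def omegaChiSet {a : ℕ} (χ : DirichletCharacter ℝ a) (n : ℕ) : Set (ℕ × ℕ) :=
  {pk : ℕ × ℕ | pk.1.Prime ∧ 1 ≤ pk.2 ∧ pk.1 ^ pk.2 ∣ n ∧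
    χ (((pk.1 ^ pk.2 : ℕ) : ZMod a)) = 1}

theorem omegaChi_eq_ncard {a : ℕ} (χ : DirichletCharacter ℝ a) (n : ℕ) :
    OmegaChi χ n = (omegaChiSet χ n).ncard := rfl

theorem omegaChiSet_finite {a : ℕ} (χ : DirichletCharacter ℝ a) {n : ℕ} (hn : 0 < n) :
    (omegaChiSet χ n).Finite := by
  refine ((Finset.range (n + 1)) ×ˢ (Finset.range (n + 1))).finite_toSet.subset ?_
  rintro ⟨p, k⟩ ⟨hp, hk, hd, -⟩
  have hle := Nat.le_of_dvd hn hd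
  have h₁ : p ≤ p ^ k := Nat.le_self_pow (by simp at hk; omega) p
  have h₂ : k < p ^ k := Nat.lt_pow_self hp.one_lt
  simp only [Finset.coe_product, Set.mem_prod, Finset.mem_coe, Finset.mem_range] at *
  omega

theorem omegaChi_add_le_mul {a : ℕ} (χ : DirichletCharacter ℝ a) {m n : ℕ} (hm : 0 < m)
    (hn : 0 < n) (hmn : m.Coprime n) : OmegaChi χ m + OmegaChi χ n ≤ OmegaChi χ (m * n) := by
  have hdisj : Disjoint (omegaChiSet χ m) (omegaChiSet χ n) := by
    rw [Set.disjoint_left]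
    rintro ⟨p, k⟩ ⟨hp, hk, hd, -⟩ ⟨-, -, hd', -⟩
    have hk0 : k ≠ 0 := by simp at hk; omega
    exact Nat.not_coprime_of_dvd_of_dvd hp.one_lt ((dvd_pow_self p hk0).trans hd)
      ((dvd_pow_self p hk0).trans hd') hmn
  simp only [omegaChi_eq_ncard]
  rw [← Set.ncard_union_eq hdisj (omegaChiSet_finite χ hm) (omegaChiSet_finite χ hn)]
  refine Set.ncard_le_ncard ?_ (omegaChiSet_finite χ (Nat.mul_pos hm hn))
  rintro ⟨p, k⟩ (⟨hp, hk, hd, h⟩ | ⟨hp, hk, hd, h⟩)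
  · exact ⟨hp, hk, hd.mul_right n, h⟩
  · exact ⟨hp, hk, hd.mul_left m, h⟩

theorem le_omegaChi_prime_pow {a : ℕ} (χ : DirichletCharacter ℝ a) {p : ℕ} (hp : p.Prime)
    (h : χ (p : ZMod a) = 1) (k : ℕ) : k ≤ OmegaChi χ (p ^ k) := by
  have hinj : Function.Injective fun j : ℕ => (p, j) := fun _ _ h => (Prod.mk.inj h).2
  have hcard : ((fun j : ℕ => (p, j)) '' (Finset.Icc 1 k : Set ℕ)).ncard = k := by
    rw [Set.ncard_image_of_injective _ hinj, Set.ncard_coe_finset, Nat.card_Icc]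
    omega
  rw [omegaChi_eq_ncard]
  conv_lhs => rw [← hcard]
  refine Set.ncard_le_ncard ?_ (omegaChiSet_finite χ (pow_pos hp.pos k))
  rintro _ ⟨j, hj, rfl⟩
  simp only [Finset.coe_Icc, Set.mem_Icc] at hj
  exact ⟨hp, hj.1, pow_dvd_pow p hj.2, by simp [h]⟩

theorem sum_divisors_sq_prime_pow_bounds {a : ℕ} (χ : DirichletCharacter ℝ a) (hχ : χ ^ 2 = 1)
    {p : ℕ} (hp : p.Prime) (k : ℕ) :
    0 < ∑ u ∈ ((p ^ k) ^ 2).divisors, χ (u : ZMod a) ∧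
      ∑ u ∈ ((p ^ k) ^ 2).divisors, χ (u : ZMod a) ≤ 3 ^ OmegaChi χ (p ^ k) := by
  rw [← pow_mul, Nat.sum_divisors_prime_pow hp]
  simp only [Nat.cast_pow, map_pow]
  have hone : (1 : ℝ) ≤ 3 ^ OmegaChi χ (p ^ k) := one_le_pow₀ (by norm_num)
  rcases MulChar.isQuadratic_iff_sq_eq_one.mpr hχ (p : ZMod a) with h | h | h
  · simpa [h, Finset.sum_range_succ'] using hone
  · have hb : 1 + (k : ℝ) * 2 ≤ (1 + 2) ^ k := one_add_mul_le_pow (by norm_num) k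
    have hp3 : (3 : ℝ) ^ k ≤ 3 ^ OmegaChi χ (p ^ k) :=
      pow_le_pow_right₀ (by norm_num) (le_omegaChi_prime_pow χ hp h k)
    norm_num at hb
    simp only [h, one_pow, Finset.sum_const, Finset.card_range, nsmul_eq_mul, mul_one]
    push_cast
    constructor
    · positivity
    · linarith
  · have hs : ∑ x ∈ Finset.range (k * 2 + 1), (-1 : ℝ) ^ x = 1 := by
      rw [neg_one_geom_sum, if_neg (by simp [parity_simps])]
    rw [h, hs]
    exact ⟨one_pos, hone⟩

/-- For a quadratic character `χ` and `g_χ(n) = ∑_{u ∣ n²} χ(u)`, one has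
`0 < g_χ(n) ≤ 3^{Ω_χ(n)}`. -/
theorem stmt15 (a : ℕ) (χ : DirichletCharacter ℝ a) (hχ : χ ^ 2 = 1)
    (n : ℕ) (hn : 0 < n) :
    0 < ∑ u ∈ (n ^ 2).divisors, χ (u : ZMod a) ∧
      ∑ u ∈ (n ^ 2).divisors, χ (u : ZMod a) ≤ 3 ^ OmegaChi χ n := by
  induction n using Nat.recOnPosPrimePosCoprime with
  | prime_pow p k hp _ => exact sum_divisors_sq_prime_pow_bounds χ hχ hp k
  | zero => exact absurd hn (lt_irrefl 0)
  | one => simpa using one_le_pow₀ (by norm_num : (1 : ℝ) ≤ 3)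
  | coprime m n hm hn hmn ihm ihn =>
    have hm0 : 0 < m := by omega
    have hn0 : 0 < n := by omega
    obtain ⟨hm1, hm2⟩ := ihm hm0
    obtain ⟨hn1, hn2⟩ := ihn hn0
    rw [mul_pow, sum_divisors_mul_dirichletCharacter χ (hmn.pow 2 2)]
    refine ⟨mul_pos hm1 hn1, (mul_le_mul hm2 hn2 hn1.le (by positivity)).trans ?_⟩
    rw [← pow_add]
    exact pow_le_pow_right₀ (by norm_num) (omegaChi_add_le_mul χ hm0 hn0 hmn)
end

section
/- Let a be a fixed positive integer and ε > 0. Then for almost all n (i.e., on a set of positive integers of natural density 1), |R(n;a) − d((n/gcd(n,a))²)/φ(a/gcd(n,a))| < (log n)^{1+ε}, where d is the number-of-divisors function and φ is Euler's totient function. -/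
open scoped Classical

/-- `R n a` is the number of ordered pairs `(x, y)` of positive integers
satisfying `a / n = 1 / x + 1 / y`. -/
noncomputable def R (n a : ℕ) : ℕ :=
  Nat.card {p : ℕ × ℕ | 0 < p.1 ∧ 0 < p.2 ∧ (a : ℚ) / n = 1 / p.1 + 1 / p.2}

lemma R_div_gcd {n a : ℕ} (ha : 0 < a) : R n a = R (n / n.gcd a) (a / n.gcd a) := by
  have hg : 0 < n.gcd a := Nat.gcd_pos_of_pos_right n ha
  have hg' : ((n.gcd a : ℕ) : ℚ) ≠ 0 := by positivity
  unfold R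
  rw [Nat.cast_div (Nat.gcd_dvd_left n a) hg', Nat.cast_div (Nat.gcd_dvd_right n a) hg',
    div_div_div_cancel_right₀ hg']

lemma unit_fraction_iff {m a x y : ℕ} (hm : 0 < m) (hx : 0 < x) (hy : 0 < y) :
    (a : ℚ) / m = 1 / x + 1 / y ↔ a * x * y = m * (x + y) := by
  rw [← @Nat.cast_inj ℚ]
  push_cast
  field_simp
  constructor <;> intro h <;> linarith

/-- For coprime `m` and `a`, the solutions of `a / m = 1 / x + 1 / y` correspond to the divisors
of `m ^ 2` congruent to `-m` modulo `a`, through `d = a * x - m`. -/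
lemma R_eq_card_divisors {m a : ℕ} (hm : 0 < m) (ha : 0 < a) (hma : m.Coprime a) :
    R m a = ((m ^ 2).divisors.filter (fun d : ℕ => -(m : ZMod a) = (d : ZMod a))).card := by
  have key : ∀ d : ℕ, -(m : ZMod a) = (d : ZMod a) ↔ a ∣ d + m := by
    intro d
    rw [← ZMod.natCast_eq_zero_iff]
    push_cast
    constructor
    · intro h; rw [← h]; ring
    · intro h; exact (eq_neg_of_add_eq_zero_left h).symm
  simp only [key]
  symm
  unfold R
  rw [Nat.card_coe_set_eq, ← Set.ncard_coe_finset]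
  refine Set.ncard_congr (fun d _ => ((d + m) / a, (m ^ 2 / d + m) / a)) ?_ ?_ ?_
  · intro d hd
    simp only [Finset.coe_filter, Nat.mem_divisors, Set.mem_ofPred_eq] at hd ⊢
    obtain ⟨⟨⟨e, he⟩, -⟩, x, hx⟩ := hd
    have hd0 : 0 < d := by
      rcases Nat.eq_zero_or_pos d with h | h
      · subst h; simp at he; omega
      · exact h
    rw [he, Nat.mul_div_cancel_left _ hd0, hx, Nat.mul_div_cancel_left _ ha]
    have h1 : a ∣ m * (e + m) := by
      have : m * (e + m) = e * (a * x) := by rw [← hx]; nlinarith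
      rw [this]
      exact ⟨e * x, by ring⟩
    obtain ⟨y, hy⟩ := (hma.symm).dvd_of_dvd_mul_left h1
    rw [hy, Nat.mul_div_cancel_left _ ha]
    have hx0 : 0 < x := by
      rcases Nat.eq_zero_or_pos x with h | h
      · subst h; omega
      · exact h
    have hy0 : 0 < y := by
      rcases Nat.eq_zero_or_pos y with h | h
      · subst h; omega
      · exact h
    refine ⟨hx0, hy0, (unit_fraction_iff hm hx0 hy0).2 ?_⟩
    apply Nat.eq_of_mul_eq_mul_left ha
    zify at he hx hy ⊢
    linear_combination (-(a:ℤ) * y) * hx - (d + m : ℤ) * hy + m * hx + m * hy - he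
  · intro d d' hd hd' h
    simp only [Finset.coe_filter, Nat.mem_divisors, Set.mem_ofPred_eq] at hd hd'
    simp only [Prod.mk.injEq] at h
    have := (Nat.div_left_inj hd.2 hd'.2).1 h.1
    omega
  · rintro ⟨x, y⟩ ⟨hx, hy, h⟩
    simp only at hx hy h
    rw [unit_fraction_iff hm hx hy] at h
    have hxm : m < a * x := by
      by_contra! hle
      have := Nat.mul_le_mul_right y hle
      nlinarith [Nat.mul_pos hm hx]
    have hym : m < a * y := by
      by_contra! hle
      have := Nat.mul_le_mul_right x hle
      nlinarith [Nat.mul_pos hm hy]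
    have hprod : (a * x - m) * (a * y - m) = m ^ 2 := by
      zify [hxm.le, hym.le] at h ⊢
      linear_combination (a : ℤ) * h
    refine ⟨a * x - m, ?_, ?_⟩
    · simp only [Finset.coe_filter, Nat.mem_divisors, Set.mem_ofPred_eq]
      refine ⟨⟨⟨_, hprod.symm⟩, by positivity⟩, ?_⟩
      rw [Nat.sub_add_cancel hxm.le]; exact dvd_mul_right _ _
    · have hpos : 0 < a * x - m := by omega
      simp only [Prod.mk.injEq]
      rw [← hprod, Nat.mul_div_cancel_left _ hpos, Nat.sub_add_cancel hxm.le,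
        Nat.sub_add_cancel hym.le, Nat.mul_div_cancel_left _ ha, Nat.mul_div_cancel_left _ ha]
      exact ⟨rfl, rfl⟩

lemma abs_R_sub_le {m a : ℕ} [NeZero a] (hm : 0 < m) (hma : m.Coprime a) :
    |(R m a : ℝ) - ((m ^ 2).divisors.card : ℝ) / (a.totient : ℝ)| ≤
      ∑ χ ∈ (Finset.univ : Finset (DirichletCharacter ℂ a)).erase 1,
        ‖∑ d ∈ (m ^ 2).divisors, χ d‖ := by
  have ha : 0 < a := Nat.pos_of_ne_zero (NeZero.ne a)
  have hφ : 0 < a.totient := Nat.totient_pos.2 ha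
  have hφ' : (1 : ℝ) ≤ a.totient := by exact_mod_cast hφ
  have hu : IsUnit (-(m : ZMod a)) := ((ZMod.isUnit_iff_coprime m a).2 hma).neg
  have h1 : (a.totient : ℂ) * R m a =
      ∑ χ : DirichletCharacter ℂ a, χ (-(m : ZMod a))⁻¹ * ∑ d ∈ (m ^ 2).divisors, χ d := by
    simp_rw [Finset.mul_sum]
    rw [Finset.sum_comm, R_eq_card_divisors hm ha hma]
    simp_rw [DirichletCharacter.sum_char_inv_mul_char_eq ℂ hu]
    rw [← Finset.sum_filter, Finset.sum_const, nsmul_eq_mul, mul_comm]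
  have hu' : IsUnit (-(m : ZMod a))⁻¹ := IsUnit.of_mul_eq_one _ (ZMod.inv_mul_of_unit _ hu)
  have h2 : (1 : DirichletCharacter ℂ a) (-(m : ZMod a))⁻¹ *
      ∑ d ∈ (m ^ 2).divisors, (1 : DirichletCharacter ℂ a) d = ((m ^ 2).divisors.card : ℂ) := by
    rw [MulChar.one_apply hu', one_mul, Finset.card_eq_sum_ones, Nat.cast_sum]
    refine Finset.sum_congr rfl fun d hd => ?_
    rw [MulChar.one_apply, Nat.cast_one]
    exact (ZMod.isUnit_iff_coprime d a).2
      (Nat.Coprime.coprime_dvd_left (Nat.dvd_of_mem_divisors hd) (hma.pow_left 2))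
  rw [← Finset.add_sum_erase _ _ (Finset.mem_univ (1 : DirichletCharacter ℂ a)), h2] at h1
  have h3 : (a.totient : ℝ) * |(R m a : ℝ) - ((m ^ 2).divisors.card : ℝ) / (a.totient : ℝ)| ≤
      ∑ χ ∈ (Finset.univ : Finset (DirichletCharacter ℂ a)).erase 1,
        ‖∑ d ∈ (m ^ 2).divisors, χ d‖ := by
    rw [← abs_of_pos (lt_of_lt_of_le one_pos hφ'), ← abs_mul, abs_of_pos (lt_of_lt_of_le one_pos hφ'),
      mul_sub, mul_div_cancel₀ _ (by positivity), ← Real.norm_eq_abs,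
      ← Complex.norm_real]
    push_cast
    rw [h1, add_sub_cancel_left]
    refine (norm_sum_le _ _).trans (Finset.sum_le_sum fun χ _ => ?_)
    rw [norm_mul]
    exact mul_le_of_le_one_left (norm_nonneg _) (χ.norm_le_one _)
  exact (le_mul_of_one_le_left (abs_nonneg _) hφ').trans h3

lemma norm_geom_sum_le {z : ℂ} (hz : z = 0 ∨ ‖z‖ = 1) (k : ℕ) :
    ‖∑ i ∈ Finset.range (2 * (k + 1) + 1), z ^ i‖ ≤ 2 + z.re + 2 * k := by
  induction k with
  | zero =>
    rcases hz with rfl | hz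
    · simp [Finset.sum_range_succ]
    · have h1 : ∑ i ∈ Finset.range (2 * (0 + 1) + 1), z ^ i = z * ((1 + 2 * z.re : ℝ) : ℂ) := by
        have h2 : z * (starRingEnd ℂ) z = 1 := by
          rw [Complex.mul_conj, Complex.normSq_eq_norm_sq, hz]; simp
        have h3 : ((1 + 2 * z.re : ℝ) : ℂ) = 1 + (z + (starRingEnd ℂ) z) := by
          rw [Complex.add_conj]; push_cast; ring
        rw [h3]
        simp only [Finset.sum_range_succ, Finset.sum_range_zero]
        linear_combination -h2
      rw [h1, norm_mul, hz, one_mul, Complex.norm_real, Real.norm_eq_abs]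
      have h4 := abs_le.1 ((Complex.abs_re_le_norm z).trans hz.le)
      rw [abs_le]
      push_cast
      constructor <;> linarith [h4.1, h4.2]
  | succ k ih =>
    have hz' : ‖z‖ ≤ 1 := by
      rcases hz with rfl | hz
      · simp
      · exact hz.le
    have h1 : ∀ j, ‖z ^ j‖ ≤ 1 := fun j => by
      rw [norm_pow]; exact pow_le_one₀ (norm_nonneg _) hz'
    rw [show 2 * (k + 1 + 1) + 1 = (2 * (k + 1) + 1) + 1 + 1 by ring, Finset.sum_range_succ,
      Finset.sum_range_succ]
    have := norm_add₃_le (a := ∑ i ∈ Finset.range (2 * (k + 1) + 1), z ^ i)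
      (b := z ^ (2 * (k + 1) + 1)) (c := z ^ (2 * (k + 1) + 1 + 1))
    push_cast
    linarith [h1 (2 * (k + 1) + 1), h1 (2 * (k + 1) + 1 + 1)]

namespace DirichletCharacter

open ArithmeticFunction

variable {q : ℕ} (χ : DirichletCharacter ℂ q)

/-- A nonnegative multiplicative function whose convolution with `1` bounds
`‖∑ d ∈ (n ^ 2).divisors, χ d‖`. -/
noncomputable def majorant : ArithmeticFunction ℝ where
  toFun n := if n = 0 then 0 else
    n.factorization.prod fun p k => if k = 1 then 1 + (χ p).re else 2
  map_zero' := if_pos rfl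

lemma majorant_apply {n : ℕ} (hn : n ≠ 0) : χ.majorant n =
    n.factorization.prod fun p k => if k = 1 then 1 + (χ p).re else 2 :=
  if_neg hn

lemma one_add_re_nonneg (n : ℕ) : 0 ≤ 1 + (χ n).re := by
  linarith [(abs_le.1 ((Complex.abs_re_le_norm (χ n)).trans (χ.norm_le_one _))).1]

lemma majorant_nonneg (n : ℕ) : 0 ≤ χ.majorant n := by
  rcases eq_or_ne n 0 with rfl | hn
  · simp
  rw [χ.majorant_apply hn]
  refine Finset.prod_nonneg fun p _ => ?_
  dsimp only
  split_ifs
  · exact χ.one_add_re_nonneg p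
  · norm_num

lemma isMultiplicative_majorant : χ.majorant.IsMultiplicative := by
  rw [IsMultiplicative.iff_ne_zero]
  refine ⟨by simp [χ.majorant_apply], fun {m n} hm hn h => ?_⟩
  rw [χ.majorant_apply hm, χ.majorant_apply hn, χ.majorant_apply (mul_ne_zero hm hn),
    Nat.factorization_mul_of_coprime h, Finsupp.prod_add_index_of_disjoint]
  exact h.disjoint_primeFactors

lemma majorant_prime {p : ℕ} (hp : p.Prime) : χ.majorant p = 1 + (χ p).re := by
  rw [χ.majorant_apply hp.ne_zero, Finsupp.prod, Nat.support_factorization, hp.primeFactors,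
    Finset.prod_singleton, hp.factorization]
  simp

lemma majorant_prime_pow {p : ℕ} (hp : p.Prime) (k : ℕ) : χ.majorant (p ^ (k + 2)) = 2 := by
  rw [χ.majorant_apply (pow_ne_zero _ hp.ne_zero), Finsupp.prod, Nat.support_factorization,
    Nat.primeFactors_prime_pow (by omega) hp, Finset.prod_singleton, hp.factorization_pow]
  simp

lemma sum_divisors_majorant_prime_pow {p : ℕ} (hp : p.Prime) (k : ℕ) :
    ∑ d ∈ (p ^ (k + 1)).divisors, χ.majorant d = 2 + (χ p).re + 2 * k := by
  rw [Nat.sum_divisors_prime_pow hp, Finset.sum_range_succ', Finset.sum_range_succ']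
  simp only [add_assoc, Nat.reduceAdd, χ.majorant_prime_pow hp, Finset.sum_const,
    Finset.card_range, nsmul_eq_mul, zero_add, pow_one, χ.majorant_prime hp, pow_zero,
    χ.isMultiplicative_majorant.map_one]
  ring

lemma zetaMul_apply (n : ℕ) : χ.zetaMul n = ∑ d ∈ n.divisors, χ d := by
  rw [zetaMul, coe_zeta_mul_apply]
  refine Finset.sum_congr rfl fun d hd => ?_
  simp [toArithmeticFunction, (Nat.pos_of_mem_divisors hd).ne']

lemma norm_sum_divisors_sq_le (n : ℕ) :
    ‖∑ d ∈ (n ^ 2).divisors, χ d‖ ≤ ∑ d ∈ n.divisors, χ.majorant d := by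
  simp only [← χ.zetaMul_apply, ← coe_zeta_mul_apply]
  have hM := isMultiplicative_zeta.natCast.mul χ.isMultiplicative_majorant
  have hZ := χ.isMultiplicative_zetaMul
  induction n using Nat.recOnPosPrimePosCoprime with
  | zero => simp
  | one => rw [one_pow, hZ.map_one, hM.map_one, norm_one]
  | prime_pow p n hp hn =>
    obtain ⟨k, rfl⟩ : ∃ k, n = k + 1 := ⟨n - 1, by omega⟩
    rw [coe_zeta_mul_apply, χ.sum_divisors_majorant_prime_pow hp, χ.zetaMul_apply, ← pow_mul,
      Nat.sum_divisors_prime_pow hp, mul_comm (k + 1)]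
    simp only [Nat.cast_pow, map_pow]
    refine norm_geom_sum_le ?_ k
    by_cases hu : IsUnit (p : ZMod q)
    · exact Or.inr (χ.unit_norm_eq_one hu.unit)
    · exact Or.inl (χ.map_nonunit hu)
  | coprime a b ha hb hab iha ihb =>
    rw [mul_pow, hZ.map_mul_of_coprime (hab.pow 2 2), hM.map_mul_of_coprime hab, norm_mul]
    exact mul_le_mul iha ihb (norm_nonneg _) ((norm_nonneg _).trans iha)

lemma rpow_neg_le_half {σ : ℝ} (hσ : 1 < σ) {p : ℕ} (hp : p.Prime) :
    (p : ℝ) ^ (-σ) ≤ 1 / 2 := by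
  have h2 : (2 : ℝ) ≤ p := by exact_mod_cast hp.two_le
  calc (p : ℝ) ^ (-σ) ≤ (p : ℝ) ^ (-1 : ℝ) :=
        Real.rpow_le_rpow_of_exponent_le (by linarith) (by linarith)
    _ = 1 / p := by rw [Real.rpow_neg_one, one_div]
    _ ≤ 1 / 2 := one_div_le_one_div_of_le (by norm_num) h2

lemma sq_rpow_neg_le {σ : ℝ} (hσ : 1 < σ) {p : ℕ} (hp : p.Prime) :
    ((p : ℝ) ^ (-σ)) ^ 2 ≤ (p : ℝ) ^ (-2 : ℝ) := by
  rw [← Real.rpow_natCast, ← Real.rpow_mul (by positivity)]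
  exact Real.rpow_le_rpow_of_exponent_le (by exact_mod_cast hp.one_le) (by push_cast; linarith)

/-- Rankin-type bound through a finite Euler product. -/
lemma sum_majorant_mul_rpow_le {σ : ℝ} (hσ : 1 < σ) (N : ℕ) :
    ∑ d ∈ Finset.Icc 1 N, χ.majorant d * (d : ℝ) ^ (-σ) ≤
      Real.exp (∑ p ∈ (N + 1).primesBelow,
        ((1 + (χ p).re) * (p : ℝ) ^ (-σ) + 4 * (p : ℝ) ^ (-2 : ℝ))) := by
  set f : ℕ → ℝ := fun d => χ.majorant d * (d : ℝ) ^ (-σ) with hf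
  have hf0 : ∀ d, 0 ≤ f d := fun d => mul_nonneg (χ.majorant_nonneg d) (by positivity)
  have hf1 : f 1 = 1 := by simp [hf, χ.isMultiplicative_majorant.map_one]
  have hmul : ∀ {m n : ℕ}, m.Coprime n → f (m * n) = f m * f n := fun {m n} h => by
    simp only [hf, χ.isMultiplicative_majorant.map_mul_of_coprime h, Nat.cast_mul]
    rw [Real.mul_rpow (by positivity) (by positivity)]
    ring
  have hx : ∀ {p : ℕ}, p.Prime → 0 ≤ (p : ℝ) ^ (-σ) ∧ (p : ℝ) ^ (-σ) ≤ 1 / 2 := fun hp =>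
    ⟨by positivity, rpow_neg_le_half hσ hp⟩
  have htail : ∀ {p : ℕ}, p.Prime → HasSum (fun k => f (p ^ (k + 2)))
      (2 * ((p : ℝ) ^ (-σ)) ^ 2 * (1 - (p : ℝ) ^ (-σ))⁻¹) := fun {p} hp => by
    obtain ⟨hx0, hx1⟩ := hx hp
    have h := (hasSum_geometric_of_lt_one hx0 (by linarith)).mul_left (2 * ((p : ℝ) ^ (-σ)) ^ 2)
    refine h.congr_fun ?_
    intro k
    simp only [hf, χ.majorant_prime_pow hp, Nat.cast_pow]
    rw [← Real.rpow_natCast, ← Real.rpow_mul (by positivity), mul_comm _ (-σ), Real.rpow_mul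
      (by positivity), Real.rpow_natCast]
    ring
  have hsum : ∀ {p : ℕ}, p.Prime → Summable (fun k => f (p ^ k)) := fun hp =>
    (summable_nat_add_iff 2).1 (htail hp).summable
  have hfac : ∀ {p : ℕ}, p.Prime → ∑' k, f (p ^ k) ≤
      Real.exp ((1 + (χ p).re) * (p : ℝ) ^ (-σ) + 4 * (p : ℝ) ^ (-2 : ℝ)) := fun {p} hp => by
    obtain ⟨hx0, hx1⟩ := hx hp
    rw [← (hsum hp).sum_add_tsum_nat_add 2, (htail hp).tsum_eq]
    have h1 : ∑ i ∈ Finset.range 2, f (p ^ i) = 1 + (1 + (χ p).re) * (p : ℝ) ^ (-σ) := by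
      simp [Finset.sum_range_succ, hf, χ.isMultiplicative_majorant.map_one, χ.majorant_prime hp]
    have h2 : (1 - (p : ℝ) ^ (-σ))⁻¹ ≤ 2 := by
      rw [inv_le_comm₀ (by linarith) (by norm_num)]; linarith
    have h3 := sq_rpow_neg_le hσ hp
    rw [h1]
    have h4 : 2 * ((p : ℝ) ^ (-σ)) ^ 2 * (1 - (p : ℝ) ^ (-σ))⁻¹ ≤ 4 * (p : ℝ) ^ (-2 : ℝ) := by
      calc _ ≤ 2 * ((p : ℝ) ^ (-σ)) ^ 2 * 2 := by gcongr
        _ ≤ _ := by linarith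
    refine le_trans ?_ (Real.add_one_le_exp _)
    linarith
  obtain ⟨hs, hprod⟩ := EulerProduct.summable_and_hasSum_smoothNumbers_prod_primesBelow_tsum
    hf1 hmul (fun hp => (hsum hp).norm) (N + 1)
  have hle : ∑ d ∈ Finset.Icc 1 N, f d ≤ ∏ p ∈ (N + 1).primesBelow, ∑' k, f (p ^ k) := by
    have hmem : ∀ d ∈ Finset.Icc 1 N, d ∈ (N + 1).smoothNumbers := fun d hd => by
      rw [Finset.mem_Icc] at hd
      exact Nat.mem_smoothNumbers_of_lt hd.1 (by omega)
    rw [← hprod.tsum_eq, ← Finset.sum_subtype_of_mem f hmem]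
    exact hprod.summable.sum_le_tsum _ (fun i _ => hf0 i)
  rw [Real.exp_sum]
  exact hle.trans (Finset.prod_le_prod (fun p _ => tsum_nonneg fun k => hf0 _)
    fun p hp => hfac (Nat.prime_of_mem_primesBelow hp))

lemma re_sub_norm_sq_le {z : ℂ} (hz : ‖z‖ ≤ 1 / 2) :
    z.re - ‖z‖ ^ 2 ≤ (-Complex.log (1 - z)).re := by
  have h := Complex.norm_log_one_add_sub_self_le (z := -z) (by rw [norm_neg]; linarith)
  rw [norm_neg, ← sub_eq_add_neg] at h
  have h1 := (Complex.abs_re_le_norm _).trans h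
  have h2 : (1 - ‖z‖)⁻¹ ≤ 2 := by
    rw [inv_le_comm₀ (by linarith) (by norm_num)]; linarith
  have h3 : ‖z‖ ^ 2 * (1 - ‖z‖)⁻¹ ≤ ‖z‖ ^ 2 * 2 := by gcongr
  have h4 := (abs_le.1 h1).2
  simp only [Complex.sub_re, Complex.neg_re] at h4 ⊢
  linarith


lemma exp_tsum_re_neg_log [NeZero q] {σ : ℝ} (hσ : 1 < σ) :
    Real.exp (∑' p : Nat.Primes, (-Complex.log (1 - χ p * (p : ℂ) ^ (-(σ : ℂ)))).re) =
      ‖χ.LFunction σ‖ := by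
  have hσ' : 1 < (σ : ℂ).re := by simpa using hσ
  rw [χ.LFunction_eq_LSeries hσ', ← χ.LSeries_eulerProduct_exp_log hσ', Complex.norm_exp,
    Complex.re_tsum (χ.summable_neg_log_one_sub_mul_prime_cpow hσ')]

lemma re_mul_rpow_sub_le {σ : ℝ} (hσ : 1 < σ) {p : ℕ} (hp : p.Prime) :
    (χ p).re * (p : ℝ) ^ (-σ) - (p : ℝ) ^ (-2 : ℝ) ≤
      (-Complex.log (1 - χ p * (p : ℂ) ^ (-(σ : ℂ)))).re := by
  have hx : (p : ℂ) ^ (-(σ : ℂ)) = ((p : ℝ) ^ (-σ) : ℝ) := by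
    rw [Complex.ofReal_cpow (by positivity)]; push_cast; rfl
  have hn : ‖χ p * (p : ℂ) ^ (-(σ : ℂ))‖ ≤ (p : ℝ) ^ (-σ) := by
    rw [hx, norm_mul, Complex.norm_real, Real.norm_of_nonneg (by positivity)]
    exact mul_le_of_le_one_left (by positivity) (χ.norm_le_one _)
  have h := re_sub_norm_sq_le (hn.trans (rpow_neg_le_half hσ hp))
  have h2 : ‖χ p * (p : ℂ) ^ (-(σ : ℂ))‖ ^ 2 ≤ (p : ℝ) ^ (-2 : ℝ) :=
    (pow_le_pow_left₀ (norm_nonneg _) hn 2).trans (sq_rpow_neg_le hσ hp)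
  have h3 : (χ p * (p : ℂ) ^ (-(σ : ℂ))).re = (χ p).re * (p : ℝ) ^ (-σ) := by
    rw [hx, Complex.re_mul_ofReal]
  linarith

lemma sum_majorant_mul_rpow_le_LFunction [NeZero q] {σ : ℝ} (hσ : 1 < σ) (N : ℕ) :
    ∑ d ∈ Finset.Icc 1 N, χ.majorant d * (d : ℝ) ^ (-σ) ≤
      Real.exp (∑' p : Nat.Primes, 6 * (p : ℝ) ^ (-2 : ℝ)) * ‖riemannZeta σ‖ *
        ‖χ.LFunction σ‖ := by
  have hσ' : 1 < (σ : ℂ).re := by simpa using hσ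
  refine (χ.sum_majorant_mul_rpow_le hσ N).trans ?_
  rw [← LFunction_modOne_eq (χ := 1), ← exp_tsum_re_neg_log _ hσ, ← exp_tsum_re_neg_log _ hσ,
    ← Real.exp_add, ← Real.exp_add, Real.exp_le_exp]
  have hs0 : Summable fun p : Nat.Primes => 6 * (p : ℝ) ^ (-2 : ℝ) :=
    (Nat.Primes.summable_rpow.2 (by norm_num)).mul_left 6
  have hs1 := (Complex.hasSum_re ((1 : DirichletCharacter ℂ 1).summable_neg_log_one_sub_mul_prime_cpow
    hσ').hasSum).summable
  have hs2 := (Complex.hasSum_re (χ.summable_neg_log_one_sub_mul_prime_cpow hσ').hasSum).summable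
  rw [← hs0.tsum_add hs1, ← (hs0.add hs1).tsum_add hs2,
    ← Finset.sum_subtype_of_mem (p := Nat.Prime) _ fun p hp => Nat.prime_of_mem_primesBelow hp]
  have hle : ∀ p : Nat.Primes, (1 + (χ p).re) * (p : ℝ) ^ (-σ) + 4 * (p : ℝ) ^ (-2 : ℝ) ≤
      6 * (p : ℝ) ^ (-2 : ℝ) +
      (-Complex.log (1 - (1 : DirichletCharacter ℂ 1) p * (p : ℂ) ^ (-(σ : ℂ)))).re +
      (-Complex.log (1 - χ p * (p : ℂ) ^ (-(σ : ℂ)))).re := fun p => by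
    have h1 := re_mul_rpow_sub_le (1 : DirichletCharacter ℂ 1) hσ p.2
    have h2 := re_mul_rpow_sub_le χ hσ p.2
    have h3 : (1 : DirichletCharacter ℂ 1) ((p : ℕ) : ZMod 1) = 1 :=
      MulChar.one_apply (isUnit_of_subsingleton _)
    have h4 : ((1 : DirichletCharacter ℂ 1) ((p : ℕ) : ZMod 1)).re = 1 := by rw [h3, Complex.one_re]
    rw [h4] at h1
    linarith
  refine (Finset.sum_le_sum fun p _ => hle p).trans
    (((hs0.add hs1).add hs2).sum_le_tsum _ fun p _ => le_trans ?_ (hle p))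
  have := χ.one_add_re_nonneg p
  positivity

open Filter Topology in
lemma exists_sum_majorant_div_le [NeZero q] (hχ : χ ≠ 1) :
    ∃ C : ℝ, ∀ᶠ N : ℕ in atTop, ∑ d ∈ Finset.Icc 1 N, χ.majorant d / d ≤ C * Real.log N := by
  have hlog : Tendsto (fun N : ℕ => Real.log N) atTop atTop :=
    Real.tendsto_log_atTop.comp tendsto_natCast_atTop_atTop
  have hσ : Tendsto (fun N : ℕ => ((1 + (Real.log N)⁻¹ : ℝ) : ℂ)) atTop (𝓝 1) := by
    have : Tendsto (fun N : ℕ => (1 + (Real.log N)⁻¹ : ℝ)) atTop (𝓝 (1 + 0)) :=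
      tendsto_const_nhds.add hlog.inv_tendsto_atTop
    rw [add_zero] at this
    rw [← Complex.ofReal_one]
    exact (Complex.continuous_ofReal.tendsto _).comp this
  have hL : Tendsto (fun N : ℕ => ‖χ.LFunction ((1 + (Real.log N)⁻¹ : ℝ) : ℂ)‖) atTop
      (𝓝 ‖χ.LFunction 1‖) :=
    (((differentiable_LFunction hχ).continuous.tendsto 1).comp hσ).norm
  have hσ' : Tendsto (fun N : ℕ => ((1 + (Real.log N)⁻¹ : ℝ) : ℂ)) atTop (𝓝[≠] 1) := by
    refine tendsto_nhdsWithin_iff.2 ⟨hσ, ?_⟩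
    filter_upwards [hlog.eventually_gt_atTop 0] with N hN
    have : 0 < (Real.log N)⁻¹ := by positivity
    rw [Set.mem_compl_singleton_iff, Ne, Complex.ofReal_eq_one]
    linarith
  have hζ := (riemannZeta_residue_one.comp hσ').norm
  rw [norm_one] at hζ
  set K := Real.exp (∑' p : Nat.Primes, 6 * (p : ℝ) ^ (-2 : ℝ))
  refine ⟨Real.exp 1 * (K * 2 * (‖χ.LFunction 1‖ + 1)), ?_⟩
  filter_upwards [hlog.eventually_gt_atTop 0, hL.eventually_le_const (lt_add_one _),
    hζ.eventually_le_const one_lt_two] with N hN h1 h2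
  have hσ1 : 1 < 1 + (Real.log N)⁻¹ := by
    have : 0 < (Real.log N)⁻¹ := by positivity
    linarith
  have h3 : ‖riemannZeta ((1 + (Real.log N)⁻¹ : ℝ) : ℂ)‖ ≤ 2 * Real.log N := by
    simp only [Function.comp_apply, norm_mul] at h2
    have h4 : ‖((1 + (Real.log N)⁻¹ : ℝ) : ℂ) - 1‖ = (Real.log N)⁻¹ := by
      rw [← Complex.ofReal_one, ← Complex.ofReal_sub, Complex.norm_real, add_sub_cancel_left,
        Real.norm_of_nonneg (by positivity)]
    rw [h4, inv_mul_le_iff₀ hN] at h2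
    linarith
  have h5 := χ.sum_majorant_mul_rpow_le_LFunction hσ1 N
  have h6 : ∑ d ∈ Finset.Icc 1 N, χ.majorant d / d ≤ Real.exp 1 *
      ∑ d ∈ Finset.Icc 1 N, χ.majorant d * (d : ℝ) ^ (-(1 + (Real.log N)⁻¹)) := by
    rw [Finset.mul_sum]
    refine Finset.sum_le_sum fun d hd => ?_
    rw [Finset.mem_Icc] at hd
    have hd0 : (0 : ℝ) < d := by exact_mod_cast hd.1
    have h7 : (d : ℝ) ^ (Real.log N)⁻¹ ≤ Real.exp 1 := by
      rw [Real.rpow_def_of_pos hd0, Real.exp_le_exp, ← div_eq_mul_inv, div_le_one hN]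
      exact Real.log_le_log hd0 (by exact_mod_cast hd.2)
    have h8 : (d : ℝ) ^ (-(1 + (Real.log N)⁻¹)) * (d : ℝ) ^ (Real.log N)⁻¹ = (d : ℝ)⁻¹ := by
      rw [← Real.rpow_add hd0, neg_add, neg_add_cancel_right, Real.rpow_neg_one]
    rw [div_eq_mul_inv, ← h8]
    have h9 := mul_le_mul_of_nonneg_left h7
      (mul_nonneg (χ.majorant_nonneg d) (Real.rpow_nonneg hd0.le (-(1 + (Real.log N)⁻¹))))
    linarith
  calc _ ≤ _ := h6
    _ ≤ Real.exp 1 * (K * (2 * Real.log N) * (‖χ.LFunction 1‖ + 1)) := by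
        gcongr
        exact h5.trans (by gcongr)
    _ = _ := by ring

lemma exists_sum_sum_majorant_le [NeZero q] (hχ : χ ≠ 1) :
    ∃ C : ℝ, ∀ᶠ N : ℕ in Filter.atTop,
      ∑ n ∈ Finset.Icc 1 N, ∑ d ∈ n.divisors, χ.majorant d ≤ C * (N * Real.log N) := by
  obtain ⟨C, hC⟩ := χ.exists_sum_majorant_div_le hχ
  refine ⟨C, hC.mono fun N hN => ?_⟩
  have h1 : ∑ n ∈ Finset.Icc 1 N, ∑ d ∈ n.divisors, χ.majorant d =
      ∑ d ∈ Finset.Icc 1 N, ((N / d : ℕ) : ℝ) * χ.majorant d := by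
    have h2 : ∀ n ∈ Finset.Icc 1 N, ∑ d ∈ n.divisors, χ.majorant d =
        ∑ d ∈ Finset.Icc 1 N, if d ∣ n then χ.majorant d else 0 := fun n hn => by
      rw [Finset.mem_Icc] at hn
      rw [← Finset.sum_filter]
      refine Finset.sum_congr (Finset.ext fun d => ?_) fun _ _ => rfl
      simp only [Nat.mem_divisors, Finset.mem_filter, Finset.mem_Icc]
      constructor
      · rintro ⟨h, -⟩
        exact ⟨⟨Nat.pos_of_dvd_of_pos h hn.1, (Nat.le_of_dvd hn.1 h).trans hn.2⟩, h⟩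
      · rintro ⟨-, h⟩
        exact ⟨h, by omega⟩
    rw [Finset.sum_congr rfl h2, Finset.sum_comm]
    refine Finset.sum_congr rfl fun d _ => ?_
    rw [← Finset.sum_filter, Finset.sum_const, nsmul_eq_mul]
    congr 2
    rw [← Nat.Ioc_filter_dvd_card_eq_div]
    rfl
  rw [h1]
  calc _ ≤ ∑ d ∈ Finset.Icc 1 N, N * (χ.majorant d / d) := by
        refine Finset.sum_le_sum fun d _ => ?_
        have := mul_le_mul_of_nonneg_right (Nat.cast_div_le (α := ℝ) (m := N) (n := d))
          (χ.majorant_nonneg d)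
        calc _ ≤ _ := this
          _ = _ := by ring
    _ = N * ∑ d ∈ Finset.Icc 1 N, χ.majorant d / d := by rw [Finset.mul_sum]
    _ ≤ N * (C * Real.log N) := by gcongr
    _ = _ := by ring

end DirichletCharacter

/-- A majorant, valid for all `n`, of the error term in the formula for `R n a`. -/
noncomputable def errorMajorant (a n : ℕ) : ℝ :=
  ∑ k ∈ Finset.range a, ∑ χ ∈ (Finset.univ : Finset (DirichletCharacter ℂ (k + 1))).erase 1,
    ∑ d ∈ n.divisors, χ.majorant d

lemma errorMajorant_nonneg (a n : ℕ) : 0 ≤ errorMajorant a n :=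
  Finset.sum_nonneg fun _ _ => Finset.sum_nonneg fun χ _ =>
    Finset.sum_nonneg fun _ _ => χ.majorant_nonneg _

lemma abs_R_sub_le_errorMajorant_of_coprime {a b m n : ℕ} (hb : 0 < b) (hba : b ≤ a) (hn : n ≠ 0)
    (hmn : m ∣ n) (hmb : m.Coprime b) :
    |(R m b : ℝ) - ((m ^ 2).divisors.card : ℝ) / (b.totient : ℝ)| ≤ errorMajorant a n := by
  obtain ⟨k, rfl⟩ : ∃ k, b = k + 1 := ⟨b - 1, by omega⟩
  have hm : 0 < m := Nat.pos_of_dvd_of_pos hmn (Nat.pos_of_ne_zero hn)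
  refine (abs_R_sub_le hm hmb).trans ?_
  refine le_trans ?_ (Finset.single_le_sum (f := fun k =>
    ∑ χ ∈ (Finset.univ : Finset (DirichletCharacter ℂ (k + 1))).erase 1,
      ∑ d ∈ n.divisors, χ.majorant d) (fun k _ => Finset.sum_nonneg fun χ _ =>
    Finset.sum_nonneg fun _ _ => χ.majorant_nonneg _) (Finset.mem_range.2 (show k < a by omega)))
  exact Finset.sum_le_sum fun χ _ => (χ.norm_sum_divisors_sq_le m).trans
    (Finset.sum_le_sum_of_subset_of_nonneg (Nat.divisors_subset_of_dvd hn hmn)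
      fun _ _ _ => χ.majorant_nonneg _)

lemma abs_R_sub_le_errorMajorant {a n : ℕ} (ha : 0 < a) (hn : 0 < n) :
    |(R n a : ℝ) - (((n / Nat.gcd n a) ^ 2).divisors.card : ℝ) /
      ((a / Nat.gcd n a).totient : ℝ)| ≤ errorMajorant a n := by
  have hg : 0 < n.gcd a := Nat.gcd_pos_of_pos_right n ha
  rw [R_div_gcd ha]
  exact abs_R_sub_le_errorMajorant_of_coprime
    (Nat.div_pos (Nat.le_of_dvd ha (Nat.gcd_dvd_right n a)) hg) (Nat.div_le_self _ _) hn.ne'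
    (Nat.div_dvd_of_dvd (Nat.gcd_dvd_left n a)) (Nat.coprime_div_gcd_div_gcd hg)

lemma exists_sum_le_of_forall_exists {ι : Type*} (s : Finset ι) (f : ι → ℕ → ℝ) (g : ℕ → ℝ)
    (h : ∀ i ∈ s, ∃ C : ℝ, ∀ᶠ N in Filter.atTop, f i N ≤ C * g N) :
    ∃ C : ℝ, ∀ᶠ N in Filter.atTop, ∑ i ∈ s, f i N ≤ C * g N := by
  choose! C hC using h
  refine ⟨∑ i ∈ s, C i, ((Filter.eventually_all_finset s).2 hC).mono fun N hN => ?_⟩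
  rw [Finset.sum_mul]
  exact Finset.sum_le_sum hN

lemma exists_sum_errorMajorant_le (a : ℕ) :
    ∃ C : ℝ, ∀ᶠ N : ℕ in Filter.atTop,
      ∑ n ∈ Finset.Icc 1 N, errorMajorant a n ≤ C * (N * Real.log N) := by
  have h : ∀ N : ℕ, ∑ n ∈ Finset.Icc 1 N, errorMajorant a n = ∑ k ∈ Finset.range a,
      ∑ χ ∈ (Finset.univ : Finset (DirichletCharacter ℂ (k + 1))).erase 1,
        ∑ n ∈ Finset.Icc 1 N, ∑ d ∈ n.divisors, χ.majorant d := fun N => by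
    unfold errorMajorant
    rw [Finset.sum_comm]
    exact Finset.sum_congr rfl fun k _ => Finset.sum_comm
  simp only [h]
  refine exists_sum_le_of_forall_exists _ _ _ fun k _ =>
    exists_sum_le_of_forall_exists _ _ _ fun χ hχ => ?_
  exact χ.exists_sum_sum_majorant_le (Finset.ne_of_mem_erase hχ)

open Filter Topology in
/-- If `E` has average order at most `log`, then `E n < (log n) ^ (1 + ε)` for almost all `n`. -/
lemma tendsto_density_one_of_sum_le {E : ℕ → ℝ} (hE : ∀ n, 0 ≤ E n) {C : ℝ}
    (hC : ∀ᶠ N : ℕ in atTop, ∑ n ∈ Finset.Icc 1 N, E n ≤ C * (N * Real.log N))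
    {ε : ℝ} (hε : 0 < ε) {P : ℕ → Prop} [DecidablePred P]
    (hP : ∀ n, 0 < n → E n < Real.log n ^ (1 + ε) → P n) :
    Tendsto (fun N : ℕ => (((Finset.Icc 1 N).filter P).card : ℝ) / N) atTop (𝓝 1) := by
  have hlog : Tendsto (fun N : ℕ => Real.log N) atTop atTop :=
    Real.tendsto_log_atTop.comp tendsto_natCast_atTop_atTop
  have hlow : Tendsto (fun N : ℕ => 1 - ((√(N : ℝ))⁻¹ + C * 2 ^ (1 + ε) * Real.log N ^ (-ε)))
      atTop (𝓝 (1 - (0 + C * 2 ^ (1 + ε) * 0))) := by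
    refine tendsto_const_nhds.sub (Tendsto.add ?_ (tendsto_const_nhds.mul ?_))
    · exact (Real.tendsto_sqrt_atTop.comp tendsto_natCast_atTop_atTop).inv_tendsto_atTop
    · exact (tendsto_rpow_neg_atTop hε).comp hlog
  rw [mul_zero, add_zero, sub_zero] at hlow
  refine tendsto_of_tendsto_of_tendsto_of_le_of_le' hlow tendsto_const_nhds ?_ ?_
  · filter_upwards [hC, hlog.eventually_gt_atTop 0, eventually_gt_atTop 0] with N hN hlN hN0
    have hN0' : (0 : ℝ) < N := by exact_mod_cast hN0
    set L := (Real.log N / 2) ^ (1 + ε) with hL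
    have hLpos : 0 < L := by positivity
    have hbad : (((Finset.Icc 1 N).filter fun n => ¬ P n).card : ℝ) ≤
        √(N : ℝ) + C * (N * Real.log N) / L := by
      have hsub : (Finset.Icc 1 N).filter (fun n => ¬ P n) ⊆
          Finset.Icc 1 N.sqrt ∪ (Finset.Icc 1 N).filter (fun n => L ≤ E n) := fun n hn => by
        simp only [Finset.mem_filter, Finset.mem_union, Finset.mem_Icc] at hn ⊢
        obtain ⟨⟨h1, h2⟩, h3⟩ := hn
        by_cases h4 : n ≤ N.sqrt
        · exact Or.inl ⟨h1, h4⟩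
        · refine Or.inr ⟨⟨h1, h2⟩, ?_⟩
          have h5 : Real.log n ^ (1 + ε) ≤ E n := not_lt.1 fun h => h3 (hP n h1 h)
          refine le_trans (Real.rpow_le_rpow (by positivity) ?_ (by positivity)) h5
          have h6 : N < n * n := Nat.sqrt_lt.1 (not_le.1 h4)
          have h7 : Real.log N ≤ Real.log ((n : ℝ) * n) :=
            Real.log_le_log hN0' (by exact_mod_cast h6.le)
          have h8 : (n : ℝ) ≠ 0 := by exact_mod_cast (show n ≠ 0 by omega)
          rw [Real.log_mul h8 h8] at h7
          linarith
      have hcard : (((Finset.Icc 1 N).filter fun n => L ≤ E n).card : ℝ) ≤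
          C * (N * Real.log N) / L := by
        rw [le_div_iff₀ hLpos, ← nsmul_eq_mul]
        calc _ ≤ ∑ n ∈ (Finset.Icc 1 N).filter (fun n => L ≤ E n), E n :=
              Finset.card_nsmul_le_sum _ _ _ fun n hn => (Finset.mem_filter.1 hn).2
          _ ≤ ∑ n ∈ Finset.Icc 1 N, E n :=
              Finset.sum_le_sum_of_subset_of_nonneg (Finset.filter_subset _ _) fun n _ _ => hE n
          _ ≤ _ := hN
      have h1 := (Finset.card_le_card hsub).trans (Finset.card_union_le _ _)
      rw [Nat.card_Icc, Nat.add_sub_cancel] at h1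
      have h2 : (((Finset.Icc 1 N).filter fun n => ¬ P n).card : ℝ) ≤
          N.sqrt + ((Finset.Icc 1 N).filter fun n => L ≤ E n).card := by exact_mod_cast h1
      linarith [Real.nat_sqrt_le_real_sqrt (a := N)]
    have hsplit : (((Finset.Icc 1 N).filter P).card : ℝ) +
        ((Finset.Icc 1 N).filter fun n => ¬ P n).card = N := by
      have := Finset.card_filter_add_card_filter_not (s := Finset.Icc 1 N) P
      rw [Nat.card_Icc, Nat.add_sub_cancel] at this
      exact_mod_cast this
    have hLeq : C * (N * Real.log N) / L = C * 2 ^ (1 + ε) * Real.log N ^ (-ε) * N := by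
      rw [hL, Real.div_rpow hlN.le (by norm_num), Real.rpow_add hlN, Real.rpow_one,
        Real.rpow_neg hlN.le]
      field_simp
    have hsqrt : √(N : ℝ) = (√(N : ℝ))⁻¹ * N := by
      have h3 : √(N : ℝ) ≠ 0 := by positivity
      field_simp
      exact Real.sq_sqrt hN0'.le
    rw [le_div_iff₀ hN0', sub_mul, add_mul, ← hLeq, ← hsqrt]
    linarith
  · refine Eventually.of_forall fun N => div_le_one_of_le₀ ?_ (by positivity)
    have := Finset.card_filter_le (Finset.Icc 1 N) P
    rw [Nat.card_Icc, Nat.add_sub_cancel] at this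
    exact_mod_cast this

/-- For almost all `n` (on a set of natural density `1`),
`|R(n;a) - d((n/(n,a))²)/φ(a/(n,a))| < (log n)^{1+ε}`. -/
theorem stmt17 (a : ℕ) (ha : 0 < a) (ε : ℝ) (hε : 0 < ε) :
    Filter.Tendsto (fun N : ℕ =>
      (((Finset.Icc 1 N).filter (fun n =>
          |(R n a : ℝ) -
              (((n / Nat.gcd n a) ^ 2).divisors.card : ℝ) /
                ((a / Nat.gcd n a).totient : ℝ)| <
            Real.log n ^ (1 + ε))).card : ℝ) / N)
      Filter.atTop (nhds 1) := by
  obtain ⟨C, hC⟩ := exists_sum_errorMajorant_le a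
  exact tendsto_density_one_of_sum_le (errorMajorant_nonneg a) hC hε fun n hn h =>
    (abs_R_sub_le_errorMajorant ha hn).trans_lt h
end

section
/- Let a be a positive integer and let χ₀ be the principal Dirichlet character modulo a. Then for all complex s with Re(s) > 1, Σ_{n ≥ 1, gcd(n,a)=1} d(n²)² · n^{−s} = L(s,χ₀)⁹ · Π_{p ∤ a} (1 + 6p^{−s} + p^{−2s})(1 − p^{−s})⁶, where d is the number-of-divisors function, L(s,χ₀) is the Dirichlet L-function of χ₀, and the product runs over primes p not dividing a. -/
open scoped Classical

lemma one_sub_ne_zero_of_norm_lt_one {𝕜 : Type*} [RCLike 𝕜] {x : 𝕜} (hx : ‖x‖ < 1) :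
    1 - x ≠ 0 := by
  intro h
  simp [← sub_eq_zero.mp h] at hx

/-- `∑ (2k+1)² x^k = (1 + 6x + x²) / (1 - x)³` for `‖x‖ < 1`. -/
lemma hasSum_odd_sq_mul_geometric {𝕜 : Type*} [RCLike 𝕜] {x : 𝕜} (hx : ‖x‖ < 1) :
    HasSum (fun k : ℕ ↦ (2 * (k : 𝕜) + 1) ^ 2 * x ^ k)
      ((1 + 6 * x + x ^ 2) / (1 - x) ^ 3) := by
  have hne := one_sub_ne_zero_of_norm_lt_one hx
  have h2 := (hasSum_choose_mul_geometric_of_norm_lt_one 2 hx).mul_left 8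
  have h1 := (hasSum_choose_mul_geometric_of_norm_lt_one 1 hx).mul_left 8
  have h0 := hasSum_choose_mul_geometric_of_norm_lt_one 0 hx
  convert! (h2.sub h1).add h0 using 1
  · funext k
    simp only [Nat.cast_choose_two, Nat.choose_one_right, Nat.choose_zero_right]
    push_cast
    ring
  · field_simp
    ring

/-- The function `n ↦ d(n²)` is multiplicative on coprime arguments. -/
lemma card_divisors_sq_mul {m n : ℕ} (h : m.Coprime n) :
    ((m * n) ^ 2).divisors.card = (m ^ 2).divisors.card * (n ^ 2).divisors.card := by
  rw [mul_pow, Nat.Coprime.card_divisors_mul (h.pow 2 2)]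

lemma card_divisors_prime_pow_sq {p : ℕ} (hp : p.Prime) (k : ℕ) :
    ((p ^ k) ^ 2).divisors.card = 2 * k + 1 := by
  rw [← pow_mul, Nat.divisors_prime_pow hp, Finset.card_map, Finset.card_range, mul_comm]

section CompletelyMultiplicative

open EulerProduct

variable {𝕜 : Type*} [RCLike 𝕜] {g : ℕ →*₀ 𝕜}

lemma hasSum_card_divisors_sq_prime_pow {p : ℕ} (hp : p.Prime) (hg : ‖g p‖ < 1) :
    HasSum (fun k : ℕ ↦ (((p ^ k) ^ 2).divisors.card : 𝕜) ^ 2 * g (p ^ k))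
      ((1 + 6 * g p + g p ^ 2) / (1 - g p) ^ 3) := by
  simpa [card_divisors_prime_pow_sq hp] using hasSum_odd_sq_mul_geometric hg

lemma summable_card_divisors_sq_mul_of_nonneg {h : ℕ →*₀ ℝ} (h0 : ∀ n, 0 ≤ h n)
    (hsum : Summable h) :
    Summable (fun n : ℕ ↦ ((n ^ 2).divisors.card : ℝ) ^ 2 * h n) := by
  set f : ℕ → ℝ := fun n ↦ ((n ^ 2).divisors.card : ℝ) ^ 2 * h n with hf
  have hf0 (n : ℕ) : 0 ≤ f n := mul_nonneg (sq_nonneg _) (h0 n)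
  have hlt {p : ℕ} (hp : p.Prime) : ‖h p‖ < 1 :=
    Summable.norm_lt_one (f := (h : ℕ →* ℝ)) hsum hp.one_lt
  have hloc {p : ℕ} (hp : p.Prime) := hasSum_card_divisors_sq_prime_pow hp (hlt hp)
  have hmul {m n : ℕ} (hmn : m.Coprime n) : f (m * n) = f m * f n := by
    simp only [hf, card_divisors_sq_mul hmn, map_mul]
    push_cast
    ring
  refine summable_of_sum_range_le (c := (∑' n, h n) ^ 9) hf0 fun N ↦ ?_
  have hsmooth := (summable_and_hasSum_smoothNumbers_prod_primesBelow_tsum (f := f)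
    (by simp [hf]) hmul (fun hp ↦ (hloc hp).summable.norm) N).2
  have hgeom := (summable_and_hasSum_smoothNumbers_prod_primesBelow_geometric
    (f := (h : ℕ →* ℝ)) hlt N).2
  calc ∑ n ∈ Finset.range N, f n
      = ∑ n ∈ Finset.range N, (N.smoothNumbers).indicator f n := by
        refine Finset.sum_congr rfl fun n hn ↦ ?_
        rcases eq_or_ne n 0 with rfl | hn0
        · rw [Set.indicator_of_notMem (fun h ↦ Nat.ne_zero_of_mem_smoothNumbers h rfl)]
          simp [hf]
        · rw [Set.indicator_of_mem]
          exact Nat.mem_smoothNumbers_of_lt (Nat.pos_of_ne_zero hn0) (Finset.mem_range.mp hn)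
    _ ≤ ∏ p ∈ N.primesBelow, ∑' k : ℕ, f (p ^ k) :=
        sum_le_hasSum _ (fun n _ ↦ Set.indicator_nonneg (fun n _ ↦ hf0 n) n)
          (hasSum_subtype_iff_indicator.mp hsmooth)
    _ ≤ ∏ p ∈ N.primesBelow, ((1 - h p)⁻¹) ^ 9 := by
        refine Finset.prod_le_prod (fun p _ ↦ tsum_nonneg fun _ ↦ hf0 _) fun p hp ↦ ?_
        have hp := Nat.prime_of_mem_primesBelow hp
        rw [(hloc hp).tsum_eq]
        have hx := h0 p
        have hx1 : h p < 1 := (le_abs_self _).trans_lt (hlt hp)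
        generalize h p = x at hx hx1
        have h1x : 0 < 1 - x := sub_pos.mpr hx1
        rw [inv_pow, div_le_iff₀ (by positivity), inv_mul_eq_div, le_div_iff₀ (by positivity)]
        have hpoly : 1 + 6 * x + x ^ 2 ≤ (1 + x) ^ 6 := by
          nlinarith [pow_nonneg hx 2, pow_nonneg hx 3, pow_nonneg hx 4, pow_nonneg hx 5,
            pow_nonneg hx 6]
        calc (1 + 6 * x + x ^ 2) * (1 - x) ^ 9 ≤ (1 + x) ^ 6 * (1 - x) ^ 9 := by gcongr
          _ = (1 - x ^ 2) ^ 6 * (1 - x) ^ 3 := by ring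
          _ ≤ 1 * (1 - x) ^ 3 := by
            gcongr
            exact pow_le_one₀ (by nlinarith) (by nlinarith)
          _ = (1 - x) ^ 3 := one_mul _
    _ = (∑' n : N.smoothNumbers, h n) ^ 9 := by
        rw [Finset.prod_pow]
        exact congrArg (· ^ 9) hgeom.tsum_eq.symm
    _ ≤ (∑' n, h n) ^ 9 := by
        gcongr
        · exact tsum_nonneg fun n ↦ h0 n
        · exact hsum.tsum_subtype_le h _ h0

lemma summable_norm_card_divisors_sq_mul (hsum : Summable (‖g ·‖)) :
    Summable (fun n : ℕ ↦ ‖((n ^ 2).divisors.card : 𝕜) ^ 2 * g n‖) := by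
  let h : ℕ →*₀ ℝ := (normHom : 𝕜 →*₀ ℝ).comp g
  simpa [h] using summable_card_divisors_sq_mul_of_nonneg (h := h) (fun n ↦ norm_nonneg (g n)) hsum

/-- If `g` is completely multiplicative with `∑ g` absolutely convergent, then
`∑ d(n²)² g(n) = (∑ g(n))⁹ ∏ (1 + 6g(p) + g(p)²)(1 - g(p))⁶`. -/
theorem tsum_card_divisors_sq_mul (hsum : Summable (‖g ·‖)) (hne : ∑' n, g n ≠ 0) :
    ∑' n : ℕ, ((n ^ 2).divisors.card : 𝕜) ^ 2 * g n =
      (∑' n, g n) ^ 9 *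
        ∏' p : Nat.Primes, (1 + 6 * g p + g p ^ 2) * (1 - g p) ^ 6 := by
  have hlt {p : ℕ} (hp : p.Prime) : ‖g p‖ < 1 :=
    Summable.norm_lt_one (f := (g : ℕ →* 𝕜)) hsum.of_norm hp.one_lt
  have hprod := eulerProduct_hasProd (f := fun n : ℕ ↦ ((n ^ 2).divisors.card : 𝕜) ^ 2 * g n)
    (by simp)
    (fun {m n} hmn ↦ by
      simp only [card_divisors_sq_mul hmn, map_mul]
      push_cast
      ring)
    (summable_norm_card_divisors_sq_mul hsum) (by simp)
  have hgeom := (eulerProduct_completely_multiplicative_hasProd hsum).inv₀ hne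
  have hquot := hprod.mul (hgeom.pow 9)
  have heq : (fun p : Nat.Primes ↦ (1 + 6 * g p + g p ^ 2) * (1 - g p) ^ 6) = fun p : Nat.Primes ↦
      (∑' k : ℕ, (((p : ℕ) ^ k) ^ 2).divisors.card ^ 2 * g ((p : ℕ) ^ k)) *
        ((1 - g p)⁻¹)⁻¹ ^ 9 := by
    funext p
    rw [(hasSum_card_divisors_sq_prime_pow p.prop (hlt p.prop)).tsum_eq]
    have h1 := one_sub_ne_zero_of_norm_lt_one (hlt p.prop)
    field_simp
  rw [heq, hquot.tprod_eq]
  field_simp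

end CompletelyMultiplicative

open scoped Classical

/-- The Dirichlet series of `d(n²)²` over integers coprime to `a` factors as
`L(s,χ₀)⁹ ∏_{p ∤ a} (1 + 6p^{-s} + p^{-2s})(1 - p^{-s})⁶` for `Re(s) > 1`. -/
theorem stmt18 (a : ℕ) [NeZero a] (s : ℂ) (hs : 1 < s.re) :
    (∑' n : ℕ, if Nat.gcd n a = 1 then
        (((n ^ 2).divisors.card : ℂ)) ^ 2 * (n : ℂ) ^ (-s) else 0) =
      DirichletCharacter.LFunction (1 : DirichletCharacter ℂ a) s ^ 9 *
        ∏' p : Nat.Primes, (if (p : ℕ) ∣ a then 1 else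
          (1 + 6 * ((p : ℕ) : ℂ) ^ (-s) + ((p : ℕ) : ℂ) ^ (-2 * s)) *
            (1 - ((p : ℕ) : ℂ) ^ (-s)) ^ 6) := by
  have hs0 := Complex.ne_zero_of_one_lt_re hs
  have hval (n : ℕ) : (1 : DirichletCharacter ℂ a) n = if n.gcd a = 1 then 1 else 0 := by
    split_ifs with h
    · exact MulChar.one_apply ((ZMod.isUnit_iff_coprime n a).mpr h)
    · exact MulChar.map_nonunit _ (mt (ZMod.isUnit_iff_coprime n a).mp h)
  have happ (n : ℕ) : dirichletSummandHom (1 : DirichletCharacter ℂ a) hs0 n =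
      if n.gcd a = 1 then (n : ℂ) ^ (-s) else 0 := by
    change (1 : DirichletCharacter ℂ a) n * (n : ℂ) ^ (-s) = _
    rw [hval]
    split_ifs <;> simp
  have hL := tsum_dirichletSummand (1 : DirichletCharacter ℂ a) hs
  have hmain := tsum_card_divisors_sq_mul
    (summable_dirichletSummand (1 : DirichletCharacter ℂ a) hs)
    (by rw [hL]; exact DirichletCharacter.LSeries_ne_zero_of_one_lt_re _ hs)
  rw [hL, ← DirichletCharacter.LFunction_eq_LSeries _ hs] at hmain
  convert hmain using 1
  · refine tsum_congr fun n ↦ ?_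
    rw [happ]
    split_ifs <;> simp
  · congr 1
    refine tprod_congr fun p ↦ ?_
    have hcop : (p : ℕ).gcd a = 1 ↔ ¬ (p : ℕ) ∣ a := p.prop.coprime_iff_not_dvd
    rw [happ]
    by_cases hpa : (p : ℕ) ∣ a
    · simp [hpa, hcop]
    · have hsq : ((p : ℕ) : ℂ) ^ (-2 * s) = (((p : ℕ) : ℂ) ^ (-s)) ^ 2 := by
        rw [← Complex.cpow_nat_mul]
        congr 1
        push_cast
        ring
      simp only [hpa, hcop, hsq, not_false_eq_true, if_true, if_false]
end

section
/- Let a be a positive integer. For Dirichlet characters χ₁, χ₂ modulo a define f_{χ₁,χ₂}(s) = Σ_{n ≥ 1} ( Σ_{u | n²} Σ_{v | n²} χ₁(u)·χ̄₂(v) ) · χ̄₁χ₂(n) · n^{−s}. Then for all complex s with Re(s) > 1, Σ_{n ≥ 1, gcd(n,a)=1} R(n;a)² · n^{−s} = (1/φ(a)²) · Σ_{χ₁ mod a} Σ_{χ₂ mod a} χ̄₁χ₂(−1) · f_{χ₁,χ₂}(s), where the outer sums run over all Dirichlet characters modulo a. -/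
open scoped Classical

/-- The Dirichlet series
`f_{χ₁,χ₂}(s) = ∑_{n ≥ 1} (∑_{u ∣ n²} ∑_{v ∣ n²} χ₁(u) χ̄₂(v)) χ̄₁χ₂(n) n^{-s}`. -/
noncomputable def f {a : ℕ} (χ₁ χ₂ : DirichletCharacter ℂ a) (s : ℂ) : ℂ :=
  ∑' n : ℕ,
    (∑ u ∈ (n ^ 2).divisors, ∑ v ∈ (n ^ 2).divisors,
        χ₁ (u : ZMod a) * (starRingEnd ℂ) (χ₂ (v : ZMod a))) *
      ((starRingEnd ℂ) (χ₁ (n : ZMod a)) * χ₂ (n : ZMod a)) * (n : ℂ) ^ (-s)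

lemma LSeriesSummable.card_divisors_pow {s : ℂ} (hs : 1 < s.re) (k : ℕ) :
    LSeriesSummable (fun n ↦ (n.divisors.card : ℂ) ^ k) s := by
  induction k with
  | zero => simpa using! LSeriesSummable_one_iff.mpr hs
  | succ k ih =>
    refine (ih.convolution ih).norm.of_norm_bounded fun n ↦ LSeries.norm_term_le s ?_
    have h : (LSeries.convolution (fun n ↦ (n.divisors.card : ℂ) ^ k)
        (fun n ↦ (n.divisors.card : ℂ) ^ k)) n =
        ((∑ p ∈ n.divisorsAntidiagonal, (p.1.divisors.card * p.2.divisors.card) ^ k : ℕ) : ℂ) := by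
      simp [LSeries.convolution_def, mul_pow]
    rw [h, ← Nat.cast_pow, Complex.norm_natCast, Complex.norm_natCast, Nat.cast_le]
    calc n.divisors.card ^ (k + 1)
        = ∑ _p ∈ n.divisorsAntidiagonal, n.divisors.card ^ k := by
          rw [Finset.sum_const, ← Nat.map_div_right_divisors, Finset.card_map, smul_eq_mul, pow_succ']
      _ ≤ _ := Finset.sum_le_sum fun p hp ↦ by
          rw [← (Nat.mem_divisorsAntidiagonal.mp hp).1, Nat.divisors_mul]
          exact Nat.pow_le_pow_left Finset.card_mul_le k

lemma Nat.card_divisors_sq_le (n : ℕ) : (n ^ 2).divisors.card ≤ n.divisors.card ^ 2 := by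
  rw [sq, sq, Nat.divisors_mul]
  exact Finset.card_mul_le

lemma R_eq_card_divisors_s19 {n a : ℕ} (ha : 0 < a) (hn : 0 < n) (h : n.gcd a = 1) :
    R n a = ((n ^ 2).divisors.filter fun u : ℕ ↦ (-n : ZMod a) = u).card := by
  have key : ∀ u : ℕ, (-n : ZMod a) = u ↔ a ∣ u + n := fun u ↦ by
    rw [← ZMod.natCast_eq_zero_iff, neg_eq_iff_add_eq_zero, add_comm]; push_cast; rfl
  have heq : ∀ x y : ℕ, 0 < x → 0 < y → ((a : ℚ) / n = 1 / x + 1 / y ↔ a * x * y = n * (x + y)) := by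
    intro x y hx hy
    have hx' : (x : ℚ) ≠ 0 := by positivity
    have hy' : (y : ℚ) ≠ 0 := by positivity
    have hn' : (n : ℚ) ≠ 0 := by positivity
    rw [← Nat.cast_inj (R := ℚ)]
    push_cast
    field_simp
    constructor <;> intro h <;> linear_combination h
  have hlt : ∀ x y : ℕ, 0 < x → 0 < y → a * x * y = n * (x + y) → n < a * x := by
    intro x y hx hy h
    by_contra! hle
    nlinarith [Nat.mul_le_mul_right y hle, Nat.mul_pos hn hx]
  change Set.ncard _ = _
  rw [← Set.ncard_coe_finset]
  refine Set.ncard_congr (fun p _ ↦ a * p.1 - n) ?_ ?_ ?_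
  · rintro ⟨x, y⟩ ⟨hx, hy, hxy⟩
    dsimp only at hx hy hxy ⊢
    rw [heq x y hx hy] at hxy
    obtain ⟨u, hu⟩ := Nat.exists_eq_add_of_lt (hlt x y hx hy hxy)
    obtain ⟨v, hv⟩ := Nat.exists_eq_add_of_lt
      (hlt y x hy hx (by rw [add_comm y, ← hxy]; ring))
    simp only [Finset.coe_filter, Nat.mem_divisors, Set.mem_ofPred_eq, key]
    have hu' : a * x - n = u + 1 := by omega
    rw [hu']
    refine ⟨⟨⟨v + 1, ?_⟩, by positivity⟩, ⟨x, by omega⟩⟩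
    have h1 : a * x * (a * y) = n * (a * x + a * y) := by linear_combination a * hxy
    rw [hu, hv] at h1
    linarith
  · rintro ⟨x, y⟩ ⟨x', y'⟩ ⟨hx, hy, hxy⟩ ⟨hx', hy', hxy'⟩ hp
    dsimp only at hx hy hxy hx' hy' hxy' hp
    have h1 := hlt x y hx hy ((heq x y hx hy).mp hxy)
    have h2 := hlt x' y' hx' hy' ((heq x' y' hx' hy').mp hxy')
    obtain rfl : x = x' := Nat.eq_of_mul_eq_mul_left ha (by omega)
    have h3 : (1 : ℚ) / y = 1 / y' := by linarith
    simpa using h3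
  · intro u hu
    simp only [Finset.coe_filter, Nat.mem_divisors, Set.mem_ofPred_eq, key] at hu
    obtain ⟨⟨⟨v, hv⟩, -⟩, x, hx⟩ := hu
    have hcop : a.Coprime u :=
      ((Nat.Coprime.pow_left 2 h).coprime_dvd_left ⟨v, hv⟩).symm
    obtain ⟨y, hy⟩ : a ∣ v + n := hcop.dvd_of_dvd_mul_left
      ⟨n * x, by rw [mul_left_comm, ← hx]; linear_combination -hv⟩
    have hx0 : 0 < x := by
      rcases Nat.eq_zero_or_pos x with rfl | h0
      · omega
      · exact h0
    have hy0 : 0 < y := by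
      rcases Nat.eq_zero_or_pos y with rfl | h0
      · omega
      · exact h0
    refine ⟨(x, y), ⟨hx0, hy0, (heq x y hx0 hy0).mpr ?_⟩, ?_⟩
    · refine Nat.eq_of_mul_eq_mul_left ha ?_
      have h1 : (u + n) * (v + n) = n * ((u + n) + (v + n)) := by linear_combination -hv
      rw [hx, hy] at h1
      linarith
    · dsimp only
      omega

lemma R_eq_sum_char {n a : ℕ} (ha : 0 < a) (hn : 0 < n) (h : n.gcd a = 1) :
    (a.totient : ℂ) * R n a = ∑ χ : DirichletCharacter ℂ a,
      (starRingEnd ℂ) (χ (-1)) * (starRingEnd ℂ) (χ n) *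
        ∑ u ∈ (n ^ 2).divisors, χ u := by
  have : NeZero a := ⟨ha.ne'⟩
  have hu : IsUnit (-n : ZMod a) := ((ZMod.isUnit_iff_coprime n a).mpr h).neg
  simp_rw [Finset.mul_sum]
  rw [Finset.sum_comm, R_eq_card_divisors_s19 ha hn h, Finset.card_filter]
  push_cast
  rw [Finset.mul_sum]
  refine Finset.sum_congr rfl fun u _ ↦ ?_
  rw [mul_ite, mul_one, mul_zero]
  convert (DirichletCharacter.sum_char_inv_mul_char_eq ℂ hu u).symm using 3 with χ
  rw [← map_mul, ← map_mul, neg_one_mul]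
  have hinv : Ring.inverse (-n : ZMod a) = (-n : ZMod a)⁻¹ := by
    rw [← hu.unit_spec, Ring.inverse_unit, ZMod.inv_coe_unit]
  rw [starRingEnd_apply, MulChar.star_apply', MulChar.inv_apply, hinv]

lemma summable_f_term {a : ℕ} (χ₁ χ₂ : DirichletCharacter ℂ a) {s : ℂ} (hs : 1 < s.re) :
    Summable fun n : ℕ ↦
      (∑ u ∈ (n ^ 2).divisors, ∑ v ∈ (n ^ 2).divisors,
        χ₁ (u : ZMod a) * (starRingEnd ℂ) (χ₂ (v : ZMod a))) *
      ((starRingEnd ℂ) (χ₁ (n : ZMod a)) * χ₂ (n : ZMod a)) * (n : ℂ) ^ (-s) := by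
  refine (LSeriesSummable.card_divisors_pow hs 4).norm.of_norm_bounded fun n ↦ ?_
  rw [LSeries.term_def₀ (by simp), norm_mul, norm_mul, norm_mul (_ ^ 4)]
  gcongr ?_ * _
  have hχ : ∀ u v : ZMod a, ‖χ₁ u * (starRingEnd ℂ) (χ₂ v)‖ ≤ 1 := fun u v ↦ by
    rw [norm_mul, RCLike.norm_conj]
    exact mul_le_one₀ (χ₁.norm_le_one u) (norm_nonneg _) (χ₂.norm_le_one v)
  have h1 : ‖(starRingEnd ℂ) (χ₁ (n : ZMod a)) * χ₂ (n : ZMod a)‖ ≤ 1 := by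
    rw [norm_mul, RCLike.norm_conj]
    exact mul_le_one₀ (χ₁.norm_le_one _) (norm_nonneg _) (χ₂.norm_le_one _)
  refine le_trans (mul_le_of_le_one_right (norm_nonneg _) h1) ?_
  refine le_trans (norm_sum_le_of_le _ fun u _ ↦ norm_sum_le_of_le _ fun v _ ↦ hχ u v) ?_
  simp only [Finset.sum_const, nsmul_eq_mul, mul_one, norm_pow, Complex.norm_natCast]
  have h2 : ((n ^ 2).divisors.card : ℝ) ≤ (n.divisors.card : ℝ) ^ 2 :=
    mod_cast Nat.card_divisors_sq_le n
  calc ((n ^ 2).divisors.card : ℝ) * (n ^ 2).divisors.card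
      ≤ (n.divisors.card : ℝ) ^ 2 * (n.divisors.card : ℝ) ^ 2 := by gcongr
    _ = (n.divisors.card : ℝ) ^ 4 := by ring

/-- The generating Dirichlet series of `R(n; a)²` for `Re(s) > 1`:
`∑_{(n,a)=1} R(n;a)² n^{-s} = (1/φ(a)²) ∑_{χ₁,χ₂ mod a} χ̄₁χ₂(-1) f_{χ₁,χ₂}(s)`. -/
theorem stmt19 (a : ℕ) (ha : 0 < a) (s : ℂ) (hs : 1 < s.re) :
    (∑' n : ℕ, if Nat.gcd n a = 1 then ((R n a : ℂ)) ^ 2 * (n : ℂ) ^ (-s) else 0) =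
      (1 / (a.totient : ℂ) ^ 2) *
        ∑ χ₁ : DirichletCharacter ℂ a, ∑ χ₂ : DirichletCharacter ℂ a,
          (starRingEnd ℂ) (χ₁ (-1)) * χ₂ (-1) * f χ₁ χ₂ s := by
  have hs0 : -s ≠ 0 := by
    rintro h
    norm_num [neg_eq_zero.mp h] at hs
  have hφ : (a.totient : ℂ) ≠ 0 := mod_cast (Nat.totient_pos.mpr ha).ne'
  have hsum (χ₁ χ₂ : DirichletCharacter ℂ a) :=
    (summable_f_term χ₁ χ₂ hs).hasSum.mul_left ((starRingEnd ℂ) (χ₁ (-1)) * χ₂ (-1))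
  have htot := (hasSum_sum (s := Finset.univ) fun χ₁ _ ↦
    hasSum_sum (s := Finset.univ) fun χ₂ _ ↦ hsum χ₁ χ₂).mul_left (1 / (a.totient : ℂ) ^ 2)
  refine Eq.trans (tsum_congr fun n ↦ ?_) htot.tsum_eq
  rcases Nat.eq_zero_or_pos n with rfl | hn
  · simp [Complex.zero_cpow hs0]
  split_ifs with h
  · have hR := R_eq_sum_char ha hn h
    have hR' := congrArg (starRingEnd ℂ) hR
    simp only [map_mul, map_sum, Complex.conj_natCast, Complex.conj_conj] at hR'
    rw [one_div, eq_inv_mul_iff_mul_eq₀ (pow_ne_zero 2 hφ)]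
    calc (a.totient : ℂ) ^ 2 * ((R n a : ℂ) ^ 2 * (n : ℂ) ^ (-s))
        = (a.totient * R n a) * (a.totient * R n a) * (n : ℂ) ^ (-s) := by ring
      _ = _ := by
        nth_rewrite 1 [hR]
        rw [hR', Finset.sum_mul_sum, Finset.sum_mul]
        refine Finset.sum_congr rfl fun χ₁ _ ↦ ?_
        rw [Finset.sum_mul]
        refine Finset.sum_congr rfl fun χ₂ _ ↦ ?_
        rw [← Finset.sum_mul_sum]
        ring
  · have hn0 (χ : DirichletCharacter ℂ a) : χ (n : ZMod a) = 0 :=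
      χ.map_nonunit fun hu ↦ h ((ZMod.isUnit_iff_coprime n a).mp hu)
    simp [hn0]
end
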